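/- Let ν ≥ −1/2, let N ≥ 0 be an integer, and let p ∈ (0,∞]. Then lim_{n→∞} n^{−2N−(2ν+2)/p} · sup over nonzero Q ∈ P_{2⌊n/2⌋,1,e} of |(Be_ν)^N(Q)(0)| / ‖Q‖_{L_{p,|t|^{2ν+1}}([−1,1])} exists and equals sup over nonzero f ∈ E_{1,1,e} with ‖f‖_{L_{p,|t|^{2ν+1}}(ℝ)} < ∞ of |(Be_ν)^N(f)(0)| / ‖f‖_{L_{p,|t|^{2ν+1}}(ℝ)} (conventions: 1/∞ = 0). Moreover, there exists a nonzero f_0 ∈ E_{1,1,e} with ‖f_0‖_{L_{p,|t|^{2ν+1}}(ℝ)} < ∞ such that this limit equals ‖(Be_ν)^N(f_0)‖_{L_∞(ℝ)} / ‖f_0‖_{L_{p,|t|^{2ν+1}}(ℝ)}. -/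

import Mathlib

open MeasureTheory Filter Topology Polynomial ENNReal

noncomputable section

/-- `f : ℂ → ℂ` is an entire function of exponential type `σ`. -/
def SphericalType1 (σ : ℝ) (f : ℂ → ℂ) : Prop :=
  Differentiable ℂ f ∧ ∀ ε : ℝ, 0 < ε → ∃ C : ℝ, ∀ z, ‖f z‖ ≤ C * Real.exp (σ * (1 + ε) * ‖z‖)

/-- The Bessel operator `Be_ν(φ)(r) = φ''(r) + (2ν+1)φ'(r)/r`, with the value at `0`
given by continuity (for even analytic `φ` this is `(2ν+2)φ''(0)`). -/
def besselOp (ν : ℝ) (f : ℂ → ℂ) : ℂ → ℂ := fun z =>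
  if z = 0 then (2*ν+2) * deriv (deriv f) 0
  else deriv (deriv f) z + (2*ν+1) * (deriv f z / z)

/-- The weighted measure `|t|^{2ν+1} dt` on a measurable set `s ⊆ ℝ`. -/
def wMeas (ν : ℝ) (s : Set ℝ) : Measure ℝ :=
  (volume.restrict s).withDensity fun t => ENNReal.ofReal (|t| ^ (2 * ν + 1))

/-- The sharp constant over even polynomials of degree at most `2⌊n/2⌋` for
`(Be_ν)^N` at `0` in `L_{p,|t|^{2ν+1}}([-1,1])`. -/
def polyConst (ν : ℝ) (N : ℕ) (p : ℝ≥0∞) (n : ℕ) : ℝ≥0∞ :=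
  ⨆ (Q : Polynomial ℂ)
    (_ : Q.natDegree ≤ 2 * (n / 2) ∧ (∀ z : ℂ, Q.eval (-z) = Q.eval z) ∧ Q ≠ 0),
    (‖(besselOp ν)^[N] (fun z => Q.eval z) 0‖₊ : ℝ≥0∞) /
      eLpNorm (fun t : ℝ => Q.eval (t : ℂ)) p (wMeas ν (Set.Icc (-1 : ℝ) 1))

/-- The sharp constant over even entire functions of exponential type `1` for
`(Be_ν)^N` at `0` in `L_{p,|t|^{2ν+1}}(ℝ)`. -/
def entireConst (ν : ℝ) (N : ℕ) (p : ℝ≥0∞) : ℝ≥0∞ :=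
  ⨆ (f : ℂ → ℂ)
    (_ : SphericalType1 1 f ∧ (∀ z : ℂ, f (-z) = f z) ∧ f ≠ 0 ∧
      eLpNorm (fun t : ℝ => f t) p (wMeas ν Set.univ) ≠ ⊤),
    (‖(besselOp ν)^[N] f 0‖₊ : ℝ≥0∞) /
      eLpNorm (fun t : ℝ => f t) p (wMeas ν Set.univ)


/-- Hardy majorant of a linear factor. -/
lemma hardy_factor (p : ℝ) (hp : 0 < p) (a : ℂ) :
    ∃ h : ℂ → ℂ, ContinuousOn h (Metric.closedBall 0 1) ∧
      (∀ w ∈ Metric.ball (0:ℂ) 1, DifferentiableAt ℂ h w) ∧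
      (∀ w, ‖w‖ ≤ 1 → ‖w - a‖ ^ p ≤ ‖h w‖) ∧ (∀ w, ‖w‖ = 1 → ‖h w‖ = ‖w - a‖ ^ p) := by
  -- find b, κ
  obtain ⟨b, κ, hb, hκ, h1, h2⟩ : ∃ (b : ℂ) (κ : ℝ), ‖b‖ ≤ 1 ∧ 0 ≤ κ ∧
      (∀ w : ℂ, ‖w‖ ≤ 1 → ‖w - a‖ ≤ κ * ‖1 - b * w‖) ∧
      (∀ w : ℂ, ‖w‖ = 1 → κ * ‖1 - b * w‖ = ‖w - a‖) := by
    have key : ∀ w : ℂ, ‖1 - (starRingEnd ℂ) a * w‖ ^ 2 - ‖w - a‖ ^ 2 =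
        (1 - ‖a‖ ^ 2) * (1 - ‖w‖ ^ 2) := by
      intro w
      simp only [← Complex.normSq_eq_norm_sq, Complex.normSq_apply]
      simp
      ring
    rcases le_or_gt ‖a‖ 1 with ha | ha
    · refine ⟨(starRingEnd ℂ) a, 1, by simpa using ha, zero_le_one, ?_, ?_⟩
      · intro w hw
        rw [one_mul]
        refine le_of_sq_le_sq ?_ (norm_nonneg _) 
        have := key w
        have h3 : 0 ≤ (1 - ‖a‖ ^ 2) * (1 - ‖w‖ ^ 2) := by
          apply mul_nonneg <;> nlinarith [norm_nonneg a, norm_nonneg w]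
        linarith
      · intro w hw
        have := key w
        rw [hw] at this
        rw [one_mul]
        refine (sq_eq_sq₀ (norm_nonneg _) (norm_nonneg _)).1 (by linarith)
    · have ha0 : a ≠ 0 := by rintro rfl; simp at ha; linarith
      have : ∀ w : ℂ, ‖a‖ * ‖1 - a⁻¹ * w‖ = ‖w - a‖ := by
        intro w
        rw [← norm_mul, mul_sub, mul_one, mul_inv_cancel_left₀ ha0, norm_sub_rev]
      refine ⟨a⁻¹, ‖a‖, ?_, norm_nonneg _, fun w _ => (this w).ge, fun w _ => this w⟩
      rw [norm_inv]
      exact inv_le_one_of_one_le₀ ha.le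
  have hpc : (0:ℝ) < ((p:ℂ)).re := by simpa using hp
  have hre : ∀ w : ℂ, ‖w‖ ≤ 1 → 1 - b * w = 0 ∨ 0 < (1 - b * w).re := by
    intro w hw
    have hbw : ‖b * w‖ ≤ 1 := by
      rw [norm_mul]; exact mul_le_one₀ hb (norm_nonneg _) hw
    have hle := (Complex.re_le_norm (b * w)).trans hbw
    rcases hle.lt_or_eq with h | h
    · right; rw [Complex.sub_re, Complex.one_re]; linarith
    · left
      have h5 : (b*w).im = 0 := by
        have h4 : ‖b*w‖^2 ≤ 1 := by nlinarith [norm_nonneg (b*w)]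
        rw [← Complex.normSq_eq_norm_sq, Complex.normSq_apply, h] at h4
        nlinarith [mul_self_nonneg (b*w).im]
      apply Complex.ext
      · rw [Complex.sub_re, h]; simp
      · rw [Complex.sub_im, h5]; simp
  refine ⟨fun w => ((κ ^ p : ℝ) : ℂ) * (1 - b * w) ^ (p : ℂ), ?_, ?_, ?_, ?_⟩
  · intro w hw
    have hw' : ‖w‖ ≤ 1 := by simpa using hw
    apply ContinuousAt.continuousWithinAt
    apply ContinuousAt.mul continuousAt_const
    have hc : ContinuousAt (fun w : ℂ => ((1 - b * w : ℂ), (p:ℂ))) w := by fun_prop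
    rcases hre w hw' with h | h
    · have := Complex.continuousAt_cpow_zero_of_re_pos hpc
      have h0 : ContinuousAt (fun x : ℂ × ℂ => x.1 ^ x.2) (1 - b * w, (p:ℂ)) := by
        rw [h]; exact this
      exact ContinuousAt.comp (g := fun x : ℂ × ℂ => x.1 ^ x.2)
        (f := fun w : ℂ => ((1 - b * w : ℂ), (p:ℂ))) h0 hc
    · have h0 : ContinuousAt (fun x : ℂ × ℂ => x.1 ^ x.2) (1 - b * w, (p:ℂ)) :=
        continuousAt_cpow (Or.inl h)
      exact ContinuousAt.comp (g := fun x : ℂ × ℂ => x.1 ^ x.2)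
        (f := fun w : ℂ => ((1 - b * w : ℂ), (p:ℂ))) h0 hc
  · intro w hw
    have hw' : ‖w‖ < 1 := by simpa using hw
    apply DifferentiableAt.const_mul
    apply DifferentiableAt.cpow_const
    · fun_prop
    · left
      have : ‖b * w‖ < 1 := by
        rw [norm_mul]; nlinarith [norm_nonneg b, norm_nonneg w]
      have hle := (Complex.re_le_norm (b * w))
      rw [Complex.sub_re, Complex.one_re]; linarith
  · intro w hw
    rw [norm_mul, Complex.norm_cpow_real, Complex.norm_real, Real.norm_of_nonneg (by positivity),
      ← Real.mul_rpow hκ (norm_nonneg _)]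
    exact Real.rpow_le_rpow (norm_nonneg _) (h1 w hw) hp.le
  · intro w hw
    rw [norm_mul, Complex.norm_cpow_real, Complex.norm_real, Real.norm_of_nonneg (by positivity),
      ← Real.mul_rpow hκ (norm_nonneg _), h2 w hw]

/-- Hardy majorant of a polynomial. -/
lemma hardy_majorant (p : ℝ) (hp : 0 < p) (q : Polynomial ℂ) :
    ∃ h : ℂ → ℂ, ContinuousOn h (Metric.closedBall 0 1) ∧
      (∀ w ∈ Metric.ball (0:ℂ) 1, DifferentiableAt ℂ h w) ∧
      (∀ w, ‖w‖ ≤ 1 → ‖q.eval w‖ ^ p ≤ ‖h w‖) ∧ (∀ w, ‖w‖ = 1 → ‖h w‖ = ‖q.eval w‖ ^ p) := by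
  have hs : q = Polynomial.C q.leadingCoeff * (q.roots.map (fun a => X - C a)).prod :=
    (IsAlgClosed.splits q).eq_prod_roots
  rw [hs]
  generalize q.leadingCoeff = c
  generalize q.roots = s
  induction s using Multiset.induction with
  | empty =>
    refine ⟨fun _ => ((‖c‖ ^ p : ℝ) : ℂ), continuousOn_const, fun _ _ => by fun_prop, ?_, ?_⟩
    · intro w _
      rw [Complex.norm_real, Real.norm_of_nonneg (by positivity)]
      simp
    · intro w _
      rw [Complex.norm_real, Real.norm_of_nonneg (by positivity)]
      simp
  | cons a s ih =>
    obtain ⟨h, h1, h2, h3, h4⟩ := ih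
    obtain ⟨g, g1, g2, g3, g4⟩ := hardy_factor p hp a
    have e : ∀ w, ‖(C c * ((a ::ₘ s).map (fun a => X - C a)).prod).eval w‖ ^ p =
        ‖w - a‖ ^ p * ‖(C c * (s.map (fun a => X - C a)).prod).eval w‖ ^ p := by
      intro w
      rw [← Real.mul_rpow (norm_nonneg _) (norm_nonneg _), ← norm_mul]
      congr 2
      simp only [Multiset.map_cons, Multiset.prod_cons, eval_mul, eval_sub, eval_X, eval_C]
      ring
    refine ⟨fun w => g w * h w, g1.mul h1, fun w hw => (g2 w hw).mul (h2 w hw), ?_, ?_⟩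
    · intro w hw
      rw [e, norm_mul]
      exact mul_le_mul (g3 w hw) (h3 w hw) (by positivity) (norm_nonneg _)
    · intro w hw
      rw [e, norm_mul, g4 w hw, h4 w hw]

/-- Pointwise bound inside the disc by the `p`-mean on the circle. -/
lemma hardy_bound (p : ℝ) (hp : 0 < p) (q : Polynomial ℂ) (w : ℂ) (hw : ‖w‖ < 1) :
    ‖q.eval w‖ ^ p ≤ (1 - ‖w‖)⁻¹ *
      ((2 * Real.pi)⁻¹ * ∫ θ in (0:ℝ)..2 * Real.pi, ‖q.eval (circleMap 0 1 θ)‖ ^ p) := by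
  obtain ⟨h, h1, h2, h3, h4⟩ := hardy_majorant p hp q
  have hC := Complex.circleIntegral_sub_inv_smul_of_differentiable_on_off_countable
    (s := ∅) (R := 1) (c := 0) (w := w) (f := h) Set.countable_empty (by simpa using hw) h1
    (by simpa using h2)
  refine (h3 w hw.le).trans ?_
  have hn : 2 * Real.pi * ‖h w‖ = ‖∮ z in C(0, 1), (z - w)⁻¹ • h z‖ := by
    rw [hC]; simp [abs_of_pos Real.pi_pos]
  have hcont : Continuous fun θ : ℝ => ‖q.eval (circleMap 0 1 θ)‖ ^ p := by
    refine Continuous.rpow_const ?_ (fun _ => Or.inr hp.le)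
    exact (q.continuous.comp (continuous_circleMap 0 1)).norm
  have hle : ‖∮ z in C(0, 1), (z - w)⁻¹ • h z‖ ≤
      ∫ θ in (0:ℝ)..2 * Real.pi, (1 - ‖w‖)⁻¹ * ‖q.eval (circleMap 0 1 θ)‖ ^ p := by
    rw [circleIntegral]
    refine intervalIntegral.norm_integral_le_of_norm_le (by positivity) ?_ ?_
    · refine Eventually.of_forall fun θ _ => ?_
      have hz : ‖circleMap 0 1 θ‖ = 1 := by simp
      rw [norm_smul, norm_smul, h4 _ hz, norm_inv]
      have : ‖deriv (circleMap 0 1) θ‖ = 1 := by simp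
      rw [this, one_mul]
      refine mul_le_mul_of_nonneg_right ?_ (by positivity)
      refine inv_anti₀ (by linarith) ?_
      calc 1 - ‖w‖ = ‖circleMap 0 1 θ‖ - ‖w‖ := by rw [hz]
        _ ≤ _ := norm_sub_norm_le _ _
    · exact (continuous_const.mul hcont).intervalIntegrable _ _
  rw [intervalIntegral.integral_const_mul] at hle
  rw [← hn] at hle
  have hpi := Real.pi_pos
  rw [mul_left_comm, ← div_eq_inv_mul, le_div_iff₀ (by positivity)]
  linarith


lemma jouk_poly (P : Polynomial ℂ) (d : ℕ) (hd : P.natDegree ≤ d) :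
    ∃ q : Polynomial ℂ, ∀ w : ℂ, w ≠ 0 → q.eval w = w ^ d * P.eval ((w + w⁻¹) / 2) := by
  refine ⟨∑ k ∈ Finset.range (d + 1), C (P.coeff k * (2⁻¹) ^ k) * (X ^ 2 + 1) ^ k * X ^ (d - k), ?_⟩
  intro w hw
  rw [eval_eq_sum_range' (Nat.lt_succ_of_le hd), eval_finsetSum, Finset.mul_sum]
  refine Finset.sum_congr rfl fun k hk => ?_
  have hk' : k ≤ d := by simpa [Nat.lt_succ_iff] using hk
  simp only [eval_mul, eval_C, eval_pow, eval_add, eval_X, eval_one]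
  have : w ^ d = w ^ (d - k) * w ^ k := by rw [← pow_add, Nat.sub_add_cancel hk']
  rw [this]
  have h2 : (w + w⁻¹) / 2 = (w ^ 2 + 1) * 2⁻¹ * w⁻¹ := by field_simp
  rw [h2, mul_pow, mul_pow, inv_pow w]
  field_simp

lemma jouk_surj (ζ : ℂ) : ∃ w : ℂ, w ≠ 0 ∧ ‖w‖ ≤ 1 ∧ ζ = (w + w⁻¹) / 2 ∧
    ‖w‖⁻¹ ≤ Real.exp ‖ζ‖ := by
  obtain ⟨w, h0, h1, h2⟩ : ∃ w : ℂ, w ≠ 0 ∧ ‖w‖ ≤ 1 ∧ ζ = (w + w⁻¹) / 2 := by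
    obtain ⟨θ, rfl⟩ := Complex.cos_surjective ζ
    have e : Complex.cos θ = (Complex.exp (θ * Complex.I) + (Complex.exp (θ * Complex.I))⁻¹) / 2 := by
      rw [← Complex.exp_neg, Complex.cos, neg_mul]
    have hne := Complex.exp_ne_zero (θ * Complex.I)
    rcases le_total ‖Complex.exp (θ * Complex.I)‖ 1 with h | h
    · exact ⟨_, hne, h, e⟩
    · refine ⟨(Complex.exp (θ * Complex.I))⁻¹, inv_ne_zero hne, ?_, ?_⟩
      · rw [norm_inv]; exact inv_le_one_of_one_le₀ h
      · rw [e, inv_inv, add_comm]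
  refine ⟨w, h0, h1, h2, ?_⟩
  have hw : 0 < ‖w‖ := norm_pos_iff.2 h0
  set t := Real.log ‖w‖⁻¹ with ht
  have het : Real.exp t = ‖w‖⁻¹ := Real.exp_log (by positivity)
  have ht0 : 0 ≤ t := Real.log_nonneg (one_le_inv₀ hw |>.2 h1)
  rw [← het]
  apply Real.exp_le_exp.2
  have hs : t ≤ Real.sinh t := Real.self_le_sinh_iff.2 ht0
  refine hs.trans ?_
  rw [Real.sinh_eq, Real.exp_neg, het, inv_inv, h2, norm_div]
  have : ‖w‖⁻¹ - ‖w‖ ≤ ‖w + w⁻¹‖ := by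
    have := norm_sub_norm_le (w⁻¹) (-w)
    rw [norm_neg, norm_inv, sub_neg_eq_add, add_comm w⁻¹] at this
    exact this
  simp only [Complex.norm_ofNat]
  linarith

lemma jouk_circle (w : ℂ) (hw : ‖w‖ = 1) : (w + w⁻¹) / 2 = ((w.re : ℝ) : ℂ) := by
  rw [Complex.inv_def, Complex.normSq_eq_norm_sq, hw]
  apply Complex.ext <;> simp

lemma bernstein_growth_one (P : Polynomial ℂ) (n : ℕ) (hn : P.natDegree ≤ n) (M : ℝ)
    (hM : ∀ x : ℝ, |x| ≤ 1 → ‖P.eval (x : ℂ)‖ ≤ M) (z : ℂ) :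
    ‖P.eval z‖ ≤ M * Real.exp (n * ‖z‖) := by
  obtain ⟨q, hq⟩ := jouk_poly P n hn
  obtain ⟨w, h0, h1, h2, h3⟩ := jouk_surj z
  have hM0 : 0 ≤ M := (norm_nonneg _).trans (hM 0 (by simp))
  have hqw : ‖q.eval w‖ ≤ M := by
    refine Complex.norm_le_of_forall_mem_frontier_norm_le (U := Metric.ball 0 1)
      Metric.isBounded_ball (f := fun w => q.eval w) q.differentiable.diffContOnCl ?_ ?_
    · intro x hx
      rw [frontier_ball _ one_ne_zero] at hx
      have hx1 : ‖x‖ = 1 := by simpa using hx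
      have hx0 : x ≠ 0 := by rintro rfl; simp at hx1
      rw [hq x hx0, norm_mul, norm_pow, hx1, one_pow, one_mul, jouk_circle x hx1]
      apply hM
      rw [← hx1]; exact Complex.abs_re_le_norm x
    · rw [closure_ball _ one_ne_zero]; simpa using h1
  have hw : 0 < ‖w‖ := norm_pos_iff.2 h0
  rw [hq w h0, ← h2, norm_mul, norm_pow] at hqw
  have : ‖P.eval z‖ ≤ M * (‖w‖⁻¹) ^ n := by
    rw [inv_pow, ← div_eq_mul_inv, le_div_iff₀ (by positivity)]; linarith
  refine this.trans ?_
  gcongr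
  rw [Real.exp_nat_mul]
  gcongr

lemma bernstein_growth (P : Polynomial ℂ) (n : ℕ) (hn : P.natDegree ≤ n) (M a : ℝ) (ha : 0 < a)
    (hM : ∀ x : ℝ, |x| ≤ a → ‖P.eval (x : ℂ)‖ ≤ M) (z : ℂ) :
    ‖P.eval z‖ ≤ M * Real.exp (n * ‖z‖ / a) := by
  have hac : (a : ℂ) ≠ 0 := by exact_mod_cast ha.ne'
  have h := bernstein_growth_one (P.comp (C (a:ℂ) * X)) n
    (by rw [natDegree_comp, natDegree_C_mul_X _ hac]; simpa using hn) M
    (by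
      intro x hx
      rw [eval_comp]; simp only [eval_mul, eval_C, eval_X]
      rw [← Complex.ofReal_mul]
      apply hM
      rw [abs_mul, abs_of_pos ha]; nlinarith) (z / a)
  rw [eval_comp] at h
  simp only [eval_mul, eval_C, eval_X] at h
  rw [mul_div_cancel₀ _ hac, norm_div, Complex.norm_real, Real.norm_of_nonneg ha.le] at h
  convert h using 3
  ring

/-- Nikolskii for cosine polynomials. -/
lemma nik_cos (p : ℝ) (hp : 0 < p) (S : Polynomial ℂ) (d : ℕ) (hd : S.natDegree ≤ d) (x : ℝ)
    (hx : |x| ≤ 1) :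
    ‖S.eval (x:ℂ)‖ ^ p ≤ Real.exp (2 * p) * (d + 2) *
      ((2 * Real.pi)⁻¹ * ∫ θ in (0:ℝ)..2 * Real.pi, ‖S.eval (Real.cos θ : ℂ)‖ ^ p) := by
  obtain ⟨q, hq⟩ := jouk_poly S d hd
  set A := (2 * Real.pi)⁻¹ * ∫ θ in (0:ℝ)..2 * Real.pi, ‖S.eval (Real.cos θ : ℂ)‖ ^ p with hA
  have hAq : A = (2 * Real.pi)⁻¹ * ∫ θ in (0:ℝ)..2 * Real.pi, ‖q.eval (circleMap 0 1 θ)‖ ^ p := by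
    rw [hA]
    congr 1
    refine intervalIntegral.integral_congr fun θ _ => ?_
    have h1 : ‖circleMap 0 1 θ‖ = 1 := by simp
    have h0 : circleMap 0 1 θ ≠ 0 := by rw [← norm_pos_iff, h1]; exact one_pos
    rw [hq _ h0, norm_mul, norm_pow, h1, one_pow, one_mul, jouk_circle _ h1]
    congr 4
    simp [circleMap, Complex.exp_ofReal_mul_I_re]
  have hA0 : 0 ≤ A := by
    rw [hA]
    refine mul_nonneg (by positivity) (intervalIntegral.integral_nonneg (by positivity) ?_)
    intro θ _; positivity
  -- the exterior circle
  set D : ℝ := (d : ℝ) + 1 with hD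
  have hD0 : 0 < D := by positivity
  set r : ℝ := 1 + 1 / D with hr
  have hr1 : 1 < r := by rw [hr]; have : 0 < 1 / D := by positivity
                         linarith
  have hB : ∀ w : ℂ, ‖w‖ = r → ‖q.eval w‖ ^ p ≤ Real.exp (2 * p) * (d + 2) * A := by
    intro w hw
    have hw0 : w ≠ 0 := by rw [← norm_pos_iff, hw]; linarith
    have e : q.eval w = w ^ (2 * d) * q.eval w⁻¹ := by
      rw [hq w hw0, hq _ (inv_ne_zero hw0), inv_inv, add_comm w⁻¹, ← mul_assoc]
      congr 1
      rw [two_mul, pow_add, mul_assoc, ← mul_pow, mul_inv_cancel₀ hw0, one_pow, mul_one]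
    have h1 : ‖w⁻¹‖ < 1 := by rw [norm_inv, hw]; exact inv_lt_one_of_one_lt₀ hr1
    have h2 := hardy_bound p hp q w⁻¹ h1
    rw [← hAq] at h2
    rw [e, norm_mul, Real.mul_rpow (norm_nonneg _) (norm_nonneg _), norm_pow, hw]
    have h3 : (r ^ (2 * d)) ^ p ≤ Real.exp (2 * p) := by
      have : r ^ (2 * d) ≤ Real.exp 2 := by
        calc r ^ (2 * d) ≤ (Real.exp (1 / D)) ^ (2 * d) := by
              gcongr
              rw [hr, add_comm]; exact Real.add_one_le_exp _
          _ = Real.exp ((2 * d : ℕ) * (1 / D)) := by rw [Real.exp_nat_mul]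
          _ ≤ Real.exp 2 := by
              apply Real.exp_le_exp.2
              push_cast
              rw [mul_one_div, div_le_iff₀ hD0, hD]; linarith
      rw [Real.exp_mul]
      exact Real.rpow_le_rpow (by positivity) this hp.le
    have h4 : (1 - ‖w⁻¹‖)⁻¹ = d + 2 := by
      rw [norm_inv, hw, hr]
      have : 1 - (1 + 1 / D)⁻¹ = (D + 1)⁻¹ := by
        field_simp
        ring
      rw [this, inv_inv, hD]; ring
    rw [h4] at h2
    rw [mul_assoc]
    exact mul_le_mul h3 h2 (by positivity) (by positivity)
  -- point on the unit circle
  set K := (Real.exp (2 * p) * (d + 2) * A) ^ (1 / p) with hK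
  have hK0 : 0 ≤ Real.exp (2 * p) * (d + 2) * A := by positivity
  set w0 := circleMap 0 1 (Real.arccos x)
  have h1 : ‖w0‖ = 1 := by simp [w0]
  have h0 : w0 ≠ 0 := by rw [← norm_pos_iff, h1]; exact one_pos
  have hre : w0.re = x := by
    simp only [w0, circleMap]
    simp [Complex.exp_ofReal_mul_I_re]
    exact Real.cos_arccos (abs_le.1 hx).1 (abs_le.1 hx).2
  have hqw : ‖q.eval w0‖ ≤ K := by
    refine Complex.norm_le_of_forall_mem_frontier_norm_le (U := Metric.ball 0 r)
      Metric.isBounded_ball (f := fun w => q.eval w) q.differentiable.diffContOnCl ?_ ?_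
    · intro y hy
      rw [frontier_ball _ (by linarith)] at hy
      have := hB y (by simpa using hy)
      rw [hK, one_div, Real.le_rpow_inv_iff_of_pos (norm_nonneg _) hK0 hp]
      exact this
    · rw [closure_ball _ (by linarith)]; simp [h1, hr1.le]
  rw [hq w0 h0, norm_mul, norm_pow, h1, one_pow, one_mul, jouk_circle w0 h1, hre] at hqw
  rwa [hK, one_div, Real.le_rpow_inv_iff_of_pos (norm_nonneg _) hK0 hp] at hqw

lemma cos_subst (F : ℝ → ℝ) (hF : Continuous F) :
    ∫ θ in (0:ℝ)..2 * Real.pi, |Real.sin θ| * F (Real.cos θ) = 2 * ∫ x in (-1:ℝ)..1, F x := by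
  have hc : Continuous fun θ => |Real.sin θ| * F (Real.cos θ) := by fun_prop
  rw [← intervalIntegral.integral_add_adjacent_intervals (b := Real.pi)
    (hc.intervalIntegrable _ _) (hc.intervalIntegrable _ _)]
  have h1 : ∫ θ in (0:ℝ)..Real.pi, |Real.sin θ| * F (Real.cos θ) = ∫ x in (-1:ℝ)..1, F x := by
    have := intervalIntegral.integral_comp_mul_deriv (a := 0) (b := Real.pi) (f := Real.cos)
      (f' := fun x => - Real.sin x) (g := F) (fun x _ => Real.hasDerivAt_cos x)
      (by fun_prop) hF
    rw [Real.cos_zero, Real.cos_pi] at this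
    rw [intervalIntegral.integral_symm 1 (-1), ← this, ← intervalIntegral.integral_neg]
    refine intervalIntegral.integral_congr fun θ hθ => ?_
    rw [Set.uIcc_of_le Real.pi_pos.le] at hθ
    have := Real.sin_nonneg_of_mem_Icc hθ
    simp only [Function.comp, abs_of_nonneg this]; ring
  have h2 : ∫ θ in Real.pi..2 * Real.pi, |Real.sin θ| * F (Real.cos θ) = ∫ x in (-1:ℝ)..1, F x := by
    have := intervalIntegral.integral_comp_mul_deriv (a := Real.pi) (b := 2 * Real.pi)
      (f := Real.cos)
      (f' := fun x => - Real.sin x) (g := F) (fun x _ => Real.hasDerivAt_cos x)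
      (by fun_prop) hF
    rw [Real.cos_two_pi, Real.cos_pi] at this
    rw [← this]
    refine intervalIntegral.integral_congr fun θ hθ => ?_
    rw [Set.uIcc_of_le (by linarith [Real.pi_pos])] at hθ
    have : Real.sin θ ≤ 0 := by
      have := Real.sin_nonneg_of_mem_Icc (x := θ - Real.pi) ⟨by linarith [hθ.1], by linarith [hθ.2]⟩
      rw [Real.sin_sub_pi] at this; linarith
    simp only [Function.comp, abs_of_nonpos this]; ring
  rw [h1, h2]; ring

lemma nik_one (p : ℝ) (hp : 0 < p) (k : ℕ) (hk : 1 ≤ 2 * (k * p)) (P : Polynomial ℂ) (m : ℕ)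
    (hm : P.natDegree ≤ m) (x : ℝ) (hx : |x| ≤ 1) :
    ((1 - x ^ 2) ^ k) ^ p * ‖P.eval (x:ℂ)‖ ^ p ≤ Real.exp (2 * p) * (m + 2 * k + 2) *
      ∫ x in (-1:ℝ)..1, ‖P.eval (x:ℂ)‖ ^ p := by
  have hS : ((1 - X ^ 2) ^ k * P : Polynomial ℂ).natDegree ≤ 2 * k + m := by
    refine natDegree_mul_le.trans (add_le_add ?_ hm)
    refine natDegree_pow_le.trans ?_
    rw [mul_comm]
    refine Nat.mul_le_mul_right _ ?_
    compute_degree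
  have hev : ∀ y : ℝ, ‖((1 - X ^ 2) ^ k * P : Polynomial ℂ).eval (y:ℂ)‖ =
      |1 - y ^ 2| ^ k * ‖P.eval (y:ℂ)‖ := by
    intro y
    simp only [eval_mul, eval_pow, eval_sub, eval_one, eval_X, norm_mul, norm_pow]
    congr 2
    rw [← Real.norm_eq_abs, ← Complex.norm_real]; push_cast; rfl
  have hx2 : 0 ≤ 1 - x ^ 2 := by
    have := sq_le_sq' (by linarith [(abs_le.1 hx).1]) (abs_le.1 hx).2
    linarith
  have h := nik_cos p hp _ _ hS x hx
  rw [hev x, abs_of_nonneg hx2, Real.mul_rpow (by positivity) (norm_nonneg _)] at h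
  refine h.trans ?_
  have hF : Continuous fun x : ℝ => ‖P.eval (x:ℂ)‖ ^ p :=
    (P.continuous.comp Complex.continuous_ofReal).norm.rpow_const (fun _ => Or.inr hp.le)
  have hle : ∫ θ in (0:ℝ)..2 * Real.pi,
      ‖((1 - X ^ 2) ^ k * P : Polynomial ℂ).eval (Real.cos θ : ℂ)‖ ^ p ≤
      2 * ∫ x in (-1:ℝ)..1, ‖P.eval (x:ℂ)‖ ^ p := by
    rw [← cos_subst _ hF]
    refine intervalIntegral.integral_mono (by positivity) ?_ ?_ ?_
    · refine Continuous.intervalIntegrable ?_ _ _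
      refine Continuous.rpow_const ?_ (fun _ => Or.inr hp.le)
      exact ((Polynomial.continuous _).comp
        (Complex.continuous_ofReal.comp Real.continuous_cos)).norm
    · refine Continuous.intervalIntegrable ?_ _ _
      exact Real.continuous_sin.abs.mul (hF.comp Real.continuous_cos)
    · intro θ
      simp only
      rw [hev, Real.mul_rpow (by positivity) (norm_nonneg _)]
      refine mul_le_mul_of_nonneg_right ?_ (by positivity)
      have : |1 - Real.cos θ ^ 2| = |Real.sin θ| ^ 2 := by
        rw [← Real.sin_sq, abs_pow]
      rw [this, ← pow_mul, ← Real.rpow_natCast, ← Real.rpow_mul (abs_nonneg _)]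
      rcases (abs_nonneg (Real.sin θ)).eq_or_lt with h0 | h0
      · rw [← h0, Real.zero_rpow]; push_cast; nlinarith
      · calc |Real.sin θ| ^ (((2 * k : ℕ):ℝ) * p) ≤ |Real.sin θ| ^ (1:ℝ) := by
              apply Real.rpow_le_rpow_of_exponent_ge h0 (Real.abs_sin_le_one θ)
              push_cast; linarith
          _ = _ := Real.rpow_one _
  set I := ∫ x in (-1:ℝ)..1, ‖P.eval (x:ℂ)‖ ^ p
  have hI : 0 ≤ I := intervalIntegral.integral_nonneg (by norm_num) fun _ _ => by positivity
  have h5 : (2 * Real.pi)⁻¹ * ∫ θ in (0:ℝ)..2 * Real.pi,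
      ‖((1 - X ^ 2) ^ k * P : Polynomial ℂ).eval (Real.cos θ : ℂ)‖ ^ p ≤ I := by
    rw [← div_eq_inv_mul, div_le_iff₀ (by positivity)]
    have := Real.pi_gt_three
    nlinarith
  have h6 : (((2 * k + m : ℕ):ℝ) + 2) = m + 2 * k + 2 := by push_cast; ring
  rw [h6]
  gcongr


lemma nik_R (p : ℝ) (hp : 0 < p) (δ : ℝ) (hδ : 0 < δ) (hδ1 : δ < 1) :
    ∃ C : ℝ, 0 < C ∧ ∀ (R : ℝ) (_ : 0 < R) (P : Polynomial ℂ) (x : ℝ) (_ : |x| ≤ (1 - δ) * R),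
      ‖P.eval (x:ℂ)‖ ^ p ≤ C * ((P.natDegree + 1) / R) * ∫ t in (-R)..R, ‖P.eval (t:ℂ)‖ ^ p := by
  obtain ⟨k, hk⟩ := exists_nat_ge (1 / (2 * p))
  have hk' : 1 ≤ 2 * (k * p) := by
    rw [div_le_iff₀ (by positivity)] at hk; linarith
  refine ⟨Real.exp (2 * p) * (2 * k + 2) / ((δ ^ k) ^ p), by positivity, ?_⟩
  intro R hR P x hx
  have hRc : (R : ℂ) ≠ 0 := by exact_mod_cast hR.ne'
  have hxR : |x / R| ≤ 1 - δ := by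
    rw [abs_div, abs_of_pos hR, div_le_iff₀ hR]; exact hx
  have h := nik_one p hp k hk' (P.comp (C (R:ℂ) * X)) P.natDegree
    (by rw [natDegree_comp, natDegree_C_mul_X _ hRc]; simp) (x / R) (by linarith)
  have e : ∀ y : ℝ, (P.comp (C (R:ℂ) * X)).eval (y:ℂ) = P.eval ((R * y : ℝ) : ℂ) := by
    intro y; rw [eval_comp]; simp
  simp only [e] at h
  rw [mul_div_cancel₀ _ hR.ne'] at h
  rw [intervalIntegral.integral_comp_mul_left (fun t => ‖P.eval (t:ℂ)‖ ^ p) hR.ne'] at h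
  rw [mul_neg, mul_one, smul_eq_mul] at h
  set I := ∫ t in (-R)..R, ‖P.eval (t:ℂ)‖ ^ p
  have hI : 0 ≤ I := intervalIntegral.integral_nonneg (by linarith) fun _ _ => by positivity
  have h1 : δ ≤ 1 - (x / R) ^ 2 := by
    have := sq_le_sq' (by linarith [(abs_le.1 hxR).1]) (abs_le.1 hxR).2
    nlinarith
  have h2 : (δ ^ k) ^ p * ‖P.eval (x:ℂ)‖ ^ p ≤ Real.exp (2 * p) * (P.natDegree + 2 * k + 2) * (R⁻¹ * I) := by
    refine le_trans ?_ h
    gcongr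
  have h3 : ((P.natDegree:ℝ) + 2 * k + 2) ≤ (2 * k + 2) * (P.natDegree + 1) := by
    have : (0:ℝ) ≤ P.natDegree := by positivity
    have : (0:ℝ) ≤ k := by positivity
    nlinarith
  have h4 : (δ ^ k) ^ p * ‖P.eval (x:ℂ)‖ ^ p ≤
      Real.exp (2 * p) * ((2 * k + 2) * (P.natDegree + 1)) * (R⁻¹ * I) := by
    refine h2.trans ?_
    gcongr
  have h5 : 0 < (δ ^ k) ^ p := by positivity
  rw [← le_div_iff₀' h5] at h4
  refine h4.trans (le_of_eq ?_)
  ring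

lemma nik_W (p : ℝ) (hp : 0 < p) (δ : ℝ) (hδ : 0 < δ) (hδ1 : δ < 1) (a : ℝ) (ha : 0 ≤ a)
    (c : ℝ) (hc : 0 < c) :
    ∃ C : ℝ, 0 < C ∧ ∀ (R : ℝ) (_ : 1 ≤ R) (P : Polynomial ℂ) (_ : (P.natDegree:ℝ) + 1 ≤ c * R)
      (x : ℝ) (_ : |x| ≤ (1 - δ) * R),
      ‖P.eval (x:ℂ)‖ ^ p ≤ C * ∫ t in (-R)..R, ‖P.eval (t:ℂ)‖ ^ p * |t| ^ a := by
  obtain ⟨C, hC, hN⟩ := nik_R p hp δ hδ hδ1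
  set η := min (1 - δ) (1 / (4 * (C * c))) with hη
  have hη0 : 0 < η := lt_min (by linarith) (by positivity)
  have hη1 : η ≤ 1 - δ := min_le_left _ _
  have hη2 : 2 * η * (C * c) ≤ 1 / 2 := by
    have : η ≤ 1 / (4 * (C * c)) := min_le_right _ _
    rw [le_div_iff₀ (by positivity)] at this
    linarith
  refine ⟨2 * (C * c) * (η ^ a)⁻¹, by positivity, ?_⟩
  intro R hR P hP x hx
  have hR0 : 0 < R := by linarith
  have hηR : η ≤ (1 - δ) * R := by nlinarith
  have hηR' : η ≤ R := by nlinarith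
  have hcont : Continuous fun t : ℝ => ‖P.eval (t:ℂ)‖ ^ p :=
    (P.continuous.comp Complex.continuous_ofReal).norm.rpow_const (fun _ => Or.inr hp.le)
  have hcontw : Continuous fun t : ℝ => ‖P.eval (t:ℂ)‖ ^ p * |t| ^ a :=
    hcont.mul (continuous_abs.rpow_const (fun _ => Or.inr ha))
  obtain ⟨y, hy, hmax⟩ := (isCompact_Icc (a := -((1-δ)*R)) (b := (1-δ)*R)).exists_isMaxOn
    ⟨0, by constructor <;> nlinarith⟩ hcont.continuousOn
  set B := ‖P.eval (y:ℂ)‖ ^ p with hB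
  have hmax' : ∀ t : ℝ, |t| ≤ (1 - δ) * R → ‖P.eval (t:ℂ)‖ ^ p ≤ B := fun t ht =>
    hmax (abs_le.1 ht)
  refine (hmax' x hx).trans ?_
  set J := ∫ t in (-R)..R, ‖P.eval (t:ℂ)‖ ^ p * |t| ^ a with hJ
  have i1 := fun u v => hcont.intervalIntegrable (μ := volume) u v
  have i2 := fun u v => hcontw.intervalIntegrable (μ := volume) u v
  have s1 : ∫ t in (-R)..R, ‖P.eval (t:ℂ)‖ ^ p = (∫ t in (-R)..(-η), ‖P.eval (t:ℂ)‖ ^ p) +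
      (∫ t in (-η)..η, ‖P.eval (t:ℂ)‖ ^ p) + ∫ t in η..R, ‖P.eval (t:ℂ)‖ ^ p := by
    rw [intervalIntegral.integral_add_adjacent_intervals (i1 _ _) (i1 _ _),
      intervalIntegral.integral_add_adjacent_intervals (i1 _ _) (i1 _ _)]
  have s2 : J = (∫ t in (-R)..(-η), ‖P.eval (t:ℂ)‖ ^ p * |t| ^ a) +
      (∫ t in (-η)..η, ‖P.eval (t:ℂ)‖ ^ p * |t| ^ a) + ∫ t in η..R, ‖P.eval (t:ℂ)‖ ^ p * |t| ^ a := by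
    rw [intervalIntegral.integral_add_adjacent_intervals (i2 _ _) (i2 _ _),
      intervalIntegral.integral_add_adjacent_intervals (i2 _ _) (i2 _ _)]
  have hmid : 0 ≤ ∫ t in (-η)..η, ‖P.eval (t:ℂ)‖ ^ p * |t| ^ a :=
    intervalIntegral.integral_nonneg (by linarith) fun _ _ => by positivity
  have hpt : ∀ t : ℝ, η ≤ |t| → ‖P.eval (t:ℂ)‖ ^ p ≤ (η ^ a)⁻¹ * (‖P.eval (t:ℂ)‖ ^ p * |t| ^ a) := by
    intro t ht
    rw [← div_eq_inv_mul, le_div_iff₀ (by positivity)]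
    gcongr
  have b1 : ∫ t in (-R)..(-η), ‖P.eval (t:ℂ)‖ ^ p ≤
      (η ^ a)⁻¹ * ∫ t in (-R)..(-η), ‖P.eval (t:ℂ)‖ ^ p * |t| ^ a := by
    rw [← intervalIntegral.integral_const_mul]
    refine intervalIntegral.integral_mono_on (by linarith) (i1 _ _) ((i2 _ _).const_mul _) ?_
    intro t ht
    apply hpt
    rw [abs_of_nonpos (by linarith [ht.2])]; linarith [ht.2]
  have b3 : ∫ t in η..R, ‖P.eval (t:ℂ)‖ ^ p ≤
      (η ^ a)⁻¹ * ∫ t in η..R, ‖P.eval (t:ℂ)‖ ^ p * |t| ^ a := by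
    rw [← intervalIntegral.integral_const_mul]
    refine intervalIntegral.integral_mono_on (by linarith) (i1 _ _) ((i2 _ _).const_mul _) ?_
    intro t ht
    apply hpt
    rw [abs_of_nonneg (by linarith [ht.1])]; linarith [ht.1]
  have b2 : ∫ t in (-η)..η, ‖P.eval (t:ℂ)‖ ^ p ≤ 2 * η * B := by
    have : ∫ t in (-η)..η, ‖P.eval (t:ℂ)‖ ^ p ≤ ∫ t in (-η)..η, B := by
      refine intervalIntegral.integral_mono_on (by linarith) (i1 _ _) (by simp) ?_
      intro t ht
      exact hmax' t ((abs_le.2 ht).trans hηR)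
    refine this.trans (le_of_eq ?_)
    rw [intervalIntegral.integral_const, smul_eq_mul]; ring
  have hηa : 0 < (η ^ a)⁻¹ := by positivity
  have s3 : ∫ t in (-R)..R, ‖P.eval (t:ℂ)‖ ^ p ≤ (η ^ a)⁻¹ * J + 2 * η * B := by
    rw [s1, s2]
    nlinarith
  have h1 := hN R hR0 P y (abs_le.2 hy)
  have h2 : ((P.natDegree:ℝ) + 1) / R ≤ c := by rw [div_le_iff₀ hR0]; exact hP
  have hB0 : 0 ≤ B := by positivity
  have hI : 0 ≤ ∫ t in (-R)..R, ‖P.eval (t:ℂ)‖ ^ p :=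
    intervalIntegral.integral_nonneg (by linarith) fun _ _ => by positivity
  have h3 : B ≤ C * c * ((η ^ a)⁻¹ * J + 2 * η * B) := by
    calc B ≤ C * ((P.natDegree + 1) / R) * ∫ t in (-R)..R, ‖P.eval (t:ℂ)‖ ^ p := h1
      _ ≤ C * c * ((η ^ a)⁻¹ * J + 2 * η * B) := by gcongr
  nlinarith

lemma wMeas_meas (a : ℝ) : Measurable fun t : ℝ => ENNReal.ofReal (|t| ^ a) := by fun_prop

lemma eLp_Icc (ν : ℝ) (hν : -(1/2 : ℝ) ≤ ν) (p : ℝ≥0∞) (hp : 0 < p) (hpt : p ≠ ⊤) (R : ℝ)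
    (hR : 0 ≤ R) (g : ℝ → ℂ) (hg : Continuous g) :
    eLpNorm g p (wMeas ν (Set.Icc (-R) R)) ^ p.toReal =
      ENNReal.ofReal (∫ t in (-R)..R, ‖g t‖ ^ p.toReal * |t| ^ (2 * ν + 1)) := by
  have hp0 : 0 < p.toReal := ENNReal.toReal_pos hp.ne' hpt
  have ha : 0 ≤ 2 * ν + 1 := by linarith
  rw [eLpNorm_eq_lintegral_rpow_enorm_toReal hp.ne' hpt, one_div, ENNReal.rpow_inv_rpow hp0.ne', wMeas,
    lintegral_withDensity_eq_lintegral_mul _ (wMeas_meas _)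
      (by exact (hg.enorm.measurable).pow_const _)]
  rw [intervalIntegral.integral_of_le (by linarith), ← integral_Icc_eq_integral_Ioc,
    ofReal_integral_eq_lintegral_ofReal]
  · refine lintegral_congr fun t => ?_
    simp only [Pi.mul_apply]
    rw [mul_comm, ENNReal.ofReal_mul (by positivity), ← ofReal_norm,
      ENNReal.ofReal_rpow_of_nonneg (norm_nonneg _) hp0.le]
  · refine Continuous.integrableOn_Icc ?_
    exact (hg.norm.rpow_const fun _ => Or.inr hp0.le).mul (continuous_abs.rpow_const fun _ => Or.inr ha)
  · exact Eventually.of_forall fun _ => by positivity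

lemma ess_bound (ν : ℝ) (s : Set ℝ) (hs : MeasurableSet s) (f : ℝ → ℂ) (hf : Continuous f) (x : ℝ) (hx : s ∈ 𝓝 x) :
    ‖f x‖ₑ ≤ eLpNorm f ⊤ (wMeas ν s) := by
  have h1 : ∀ᵐ t ∂(wMeas ν s), ‖f t‖ₑ ≤ eLpNorm f ⊤ (wMeas ν s) := by
    rw [eLpNorm_exponent_top]; exact ae_le_eLpNormEssSup
  set M := eLpNorm f ⊤ (wMeas ν s)
  have hac : (volume.restrict s) ≪ wMeas ν s := by
    refine withDensity_absolutelyContinuous' (wMeas_meas _).aemeasurable ?_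
    apply ae_restrict_of_ae
    have : ∀ᵐ t : ℝ, t ≠ 0 := Measure.ae_ne volume 0
    filter_upwards [this] with t ht
    have : 0 < |t| := abs_pos.2 ht
    simp only [ne_eq, ENNReal.ofReal_eq_zero, not_le]
    positivity
  have h2 : ∀ᵐ t ∂(volume.restrict s), ‖f t‖ₑ ≤ M := hac.ae_le h1
  rw [ae_restrict_iff' hs] at h2
  have hd := Measure.dense_of_ae h2
  have hcl : IsClosed {t | ‖f t‖ₑ ≤ M} := isClosed_le hf.enorm continuous_const
  refine hcl.closure_subset_iff.2 (?_ : interior s ∩ {t | t ∈ s → ‖f t‖ₑ ≤ M} ⊆ _)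
    (hd.open_subset_closure_inter isOpen_interior (mem_interior_iff_mem_nhds.2 hx))
  rintro t ⟨h3, h4⟩
  exact h4 (interior_subset h3)

/-- Weighted Nikolskii inequality for polynomials, in `eLpNorm` form. -/
lemma nik_eLp (ν : ℝ) (hν : -(1/2 : ℝ) ≤ ν) (p : ℝ≥0∞) (hp : 0 < p) (δ : ℝ) (hδ : 0 < δ)
    (hδ1 : δ < 1) (c : ℝ) (hc : 0 < c) :
    ∃ C : ℝ, 0 < C ∧ ∀ (R : ℝ) (_ : 1 ≤ R) (P : Polynomial ℂ) (_ : (P.natDegree:ℝ) + 1 ≤ c * R)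
      (x : ℝ) (_ : |x| ≤ (1 - δ) * R),
      ‖P.eval (x:ℂ)‖ₑ ≤ ENNReal.ofReal C *
        eLpNorm (fun t : ℝ => P.eval (t:ℂ)) p (wMeas ν (Set.Icc (-R) R)) := by
  by_cases hpt : p = ⊤
  · subst hpt
    refine ⟨1, one_pos, ?_⟩
    intro R hR P _ x hx
    rw [ENNReal.ofReal_one, one_mul]
    refine ess_bound ν _ measurableSet_Icc _ (P.continuous.comp Complex.continuous_ofReal) x ?_
    apply _root_.Icc_mem_nhds <;> nlinarith [(abs_le.1 hx).1, (abs_le.1 hx).2]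
  · have hp0 : 0 < p.toReal := ENNReal.toReal_pos hp.ne' hpt
    obtain ⟨C, hC, h⟩ := nik_W p.toReal hp0 δ hδ hδ1 (2 * ν + 1) (by linarith) c hc
    refine ⟨C ^ (p.toReal)⁻¹, by positivity, ?_⟩
    intro R hR P hP x hx
    have h1 := h R hR P hP x hx
    rw [← ENNReal.rpow_le_rpow_iff hp0, ENNReal.mul_rpow_of_nonneg _ _ hp0.le,
      eLp_Icc ν hν p hp hpt R (by linarith) (fun t : ℝ => P.eval (t:ℂ))
        (P.continuous.comp Complex.continuous_ofReal),
      ENNReal.ofReal_rpow_of_nonneg (by positivity) hp0.le, Real.rpow_inv_rpow hC.le hp0.ne',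
      ← ENNReal.ofReal_mul hC.le, ← ofReal_norm,
      ENNReal.ofReal_rpow_of_nonneg (norm_nonneg _) hp0.le]
    exact ENNReal.ofReal_le_ofReal h1


/-- Taylor coefficients. -/
def tc (f : ℂ → ℂ) (k : ℕ) : ℂ := (k.factorial : ℂ)⁻¹ * iteratedDeriv k f 0

lemma tc_hasSum (f : ℂ → ℂ) (hf : Differentiable ℂ f) (z : ℂ) :
    HasSum (fun k => tc f k * z ^ k) (f z) := by
  have h := Complex.hasSum_taylorSeries_of_entire hf 0 z
  refine h.congr_fun ?_ |>.trans ?_ <;> simp [tc] <;> try (intro k; ring)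

lemma tc_bound (f : ℂ → ℂ) (hf : Differentiable ℂ f) (R K : ℝ) (hR : 0 < R)
    (hK : ∀ z, ‖z‖ = R → ‖f z‖ ≤ K) (k : ℕ) : ‖tc f k‖ ≤ K / R ^ k := by
  have h := Complex.norm_iteratedDeriv_le_of_forall_mem_sphere_norm_le (c := 0) k hR
    hf.diffContOnCl (C := K) (fun z hz => hK z (by simpa using hz))
  have hk : (0:ℝ) < k.factorial := by positivity
  rw [tc, norm_mul, norm_inv, Complex.norm_natCast, inv_mul_le_iff₀ hk]
  rw [mul_div_assoc] at h; exact h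

lemma taylor_approx (f : ℂ → ℂ) (hf : Differentiable ℂ f) (R K : ℝ) (hR : 0 < R)
    (hK : ∀ z, ‖z‖ ≤ Real.exp 1 * R → ‖f z‖ ≤ K) (m : ℕ) :
    ∃ G : Polynomial ℂ, G.natDegree ≤ m ∧
      ∀ z, ‖z‖ ≤ R → ‖f z - G.eval z‖ ≤ K * Real.exp (-m) := by
  have hK0 : 0 ≤ K := (norm_nonneg _).trans (hK 0 (by simp; positivity))
  refine ⟨∑ k ∈ Finset.range (m+1), C (tc f k) * X ^ k, ?_, ?_⟩
  · refine natDegree_sum_le_of_forall_le _ _ fun k hk => ?_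
    exact (natDegree_C_mul_X_pow_le _ _).trans (by simp at hk; omega)
  intro z hz
  have h := tc_hasSum f hf z
  have h1 := (hasSum_nat_add_iff' (m+1)).2 h
  have e : f z - (∑ k ∈ Finset.range (m+1), C (tc f k) * X ^ k).eval z =
    f z - ∑ i ∈ Finset.range (m + 1), tc f i * z ^ i := by
    simp [eval_finsetSum]
  rw [e, ← h1.tsum_eq]
  have hq : Real.exp (-1) < 1/2 := by
    rw [Real.exp_neg, one_div]
    exact inv_strictAnti₀ (by norm_num) (by linarith [Real.exp_one_gt_d9])
  have hq0 := Real.exp_pos (-1)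
  have hg := ((hasSum_geometric_of_lt_one hq0.le (by linarith : Real.exp (-1) < 1)).mul_left
    (K * Real.exp (-1) ^ (m+1)))
  refine (tsum_of_norm_bounded hg ?_).trans ?_
  · intro i
    rw [norm_mul, norm_pow]
    have hb := tc_bound f hf (Real.exp 1 * R) K (by positivity) (fun z hz => hK z hz.le) (i + (m+1))
    calc _ ≤ K / (Real.exp 1 * R) ^ (i + (m+1)) * R ^ (i + (m+1)) := by gcongr
      _ = K * (Real.exp 1)⁻¹ ^ (i + (m+1)) := by
        rw [mul_pow, inv_pow]; field_simp
      _ ≤ _ := by rw [Real.exp_neg, pow_add]; apply le_of_eq; ring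
  · have e2 : Real.exp (-(m:ℝ)) = Real.exp (-1) ^ m := by
      rw [← Real.exp_nat_mul]; congr 1; ring
    rw [e2, pow_succ, mul_assoc, mul_assoc]
    refine mul_le_mul_of_nonneg_left ?_ hK0
    rw [← div_eq_mul_inv]
    have : Real.exp (-1) / (1 - Real.exp (-1)) ≤ 1 := by
      rw [div_le_one (by linarith)]; linarith
    exact mul_le_of_le_one_right (by positivity) this

lemma wMeas_univ_le (ν : ℝ) (hν : -(1/2) ≤ ν) (R : ℝ) (hR : 0 < R) :
    wMeas ν (Set.Icc (-R) R) Set.univ ≤ ENNReal.ofReal (2 * R ^ (2*ν+2)) := by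
  rw [wMeas, withDensity_apply _ MeasurableSet.univ, Measure.restrict_univ]
  calc _ ≤ ∫⁻ t in Set.Icc (-R) R, ENNReal.ofReal (R ^ (2*ν+1)) := by
        refine setLIntegral_mono measurable_const fun t ht => ?_
        exact ENNReal.ofReal_le_ofReal (Real.rpow_le_rpow (abs_nonneg _) (abs_le.2 ht) (by linarith))
    _ = ENNReal.ofReal (2 * R ^ (2*ν+2)) := by
        rw [setLIntegral_const, Real.volume_Icc, ← ENNReal.ofReal_mul (by positivity)]
        congr 1
        have : R ^ (2*ν+2) = R ^ (2*ν+1) * R := by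
          rw [show 2*ν+2 = (2*ν+1)+1 by ring, Real.rpow_add hR, Real.rpow_one]
        rw [this]; ring

lemma smallErr (ν : ℝ) (hν : -(1/2) ≤ ν) (p : ℝ≥0∞) (C γ : ℝ) (hγ : 0 < γ)
    (g : ℕ → ℝ → ℂ) (hg : ∀ᶠ n : ℕ in atTop, ∀ t : ℝ, |t| ≤ n → ‖g n t‖ ≤ C * Real.exp (-(γ * n))) :
    Tendsto (fun n : ℕ => eLpNorm (g n) p (wMeas ν (Set.Icc (-(n:ℝ)) n))) atTop (𝓝 0) := by
  set q := p.toReal⁻¹ with hqd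
  have hq : 0 ≤ q := by positivity
  have hlim : Tendsto (fun n : ℕ => ENNReal.ofReal ((2 ^ q * C) * ((n:ℝ) ^ ((2*ν+2)*q) * Real.exp (-γ * n))))
      atTop (𝓝 0) := by
    have h1 := (tendsto_rpow_mul_exp_neg_mul_atTop_nhds_zero ((2*ν+2)*q) γ hγ).comp
      (tendsto_natCast_atTop_atTop (R := ℝ))
    have h2 := ENNReal.tendsto_ofReal (h1.const_mul (2 ^ q * C))
    simpa using h2
  refine tendsto_of_tendsto_of_tendsto_of_le_of_le' tendsto_const_nhds hlim (by simp) ?_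
  filter_upwards [hg, eventually_gt_atTop 0] with n hn hn0
  have hR : (0:ℝ) < n := by exact_mod_cast hn0
  have hb : ∀ᵐ t ∂(wMeas ν (Set.Icc (-(n:ℝ)) n)), ‖g n t‖ ≤ C * Real.exp (-(γ * n)) := by
    have hac : wMeas ν (Set.Icc (-(n:ℝ)) n) ≪ volume.restrict (Set.Icc (-(n:ℝ)) n) :=
      withDensity_absolutelyContinuous _ _
    refine hac.ae_le ?_
    filter_upwards [ae_restrict_mem measurableSet_Icc] with t ht
    exact hn t (abs_le.2 ht)
  refine (eLpNorm_le_of_ae_bound hb).trans ?_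
  calc _ ≤ ENNReal.ofReal (2 * (n:ℝ) ^ (2*ν+2)) ^ q * ENNReal.ofReal (C * Real.exp (-(γ * n))) := by
        gcongr; exact wMeas_univ_le ν hν n hR
    _ = _ := by
        rw [ENNReal.ofReal_rpow_of_nonneg (by positivity) hq, ← ENNReal.ofReal_mul (by positivity)]
        congr 1
        rw [Real.mul_rpow (by norm_num) (by positivity), ← Real.rpow_mul hR.le]
        rw [show -(γ * (n:ℝ)) = -γ * n by ring]; ring

lemma wMeas_mono (ν : ℝ) {s t : Set ℝ} (h : s ⊆ t) : wMeas ν s ≤ wMeas ν t := by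
  rw [wMeas, wMeas]
  refine Measure.le_iff.2 fun u hu => ?_
  rw [withDensity_apply _ hu, withDensity_apply _ hu]
  exact lintegral_mono' (Measure.restrict_mono le_rfl (Measure.restrict_mono h le_rfl)) le_rfl


lemma bdd_real (ν : ℝ) (hν : -(1/2) ≤ ν) (p : ℝ≥0∞) (hp : 0 < p) (f : ℂ → ℂ)
    (hf : Differentiable ℂ f) (C B : ℝ) (hB : 0 ≤ B) (hC : ∀ z, ‖f z‖ ≤ C * Real.exp (B * ‖z‖))
    (hfin : eLpNorm (fun t : ℝ => f t) p (wMeas ν Set.univ) ≠ ⊤) :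
    ∃ M : ℝ, ∀ x : ℝ, ‖f x‖ ≤ M := by
  have hC0 : 0 ≤ C := by have := (norm_nonneg _).trans (hC 0); simpa using this
  -- degree of approximation
  set D : ℕ := ⌈B * Real.exp 1⌉₊ + 1 with hD
  have hDB : B * Real.exp 1 + 1 ≤ D := by
    rw [hD]; push_cast; linarith [Nat.le_ceil (B * Real.exp 1)]
  have hG : ∀ n : ℕ, ∃ G : Polynomial ℂ, 0 < n → G.natDegree ≤ D * n ∧
      ∀ z, ‖z‖ ≤ n → ‖f z - G.eval z‖ ≤ C * Real.exp (-(1 * n)) := by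
    intro n
    by_cases hn : 0 < n
    swap
    · exact ⟨0, fun h => absurd h hn⟩
    have hnR : (0:ℝ) < n := by exact_mod_cast hn
    obtain ⟨G, h1, h2⟩ := taylor_approx f hf n (C * Real.exp (B * (Real.exp 1 * n))) hnR
      (fun z hz => (hC z).trans (by gcongr)) (D * n)
    refine ⟨G, fun _ => ⟨h1, fun z hz => (h2 z hz).trans ?_⟩⟩
    rw [mul_assoc, ← Real.exp_add]
    gcongr
    push_cast
    nlinarith
  choose G hG using hG
  have herr := smallErr ν hν p C 1 one_pos (fun n t => f t - (G n).eval (t:ℂ)) (by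
    filter_upwards [eventually_gt_atTop 0] with n hn t ht
    exact (hG n hn).2 t (by simpa using ht))
  obtain ⟨K, hK0, hK⟩ := nik_eLp ν hν p hp (1/2) (by norm_num) (by norm_num) (D + 1) (by positivity)
  set A := ENNReal.ofReal K * (p.LpAddConst * (eLpNorm (fun t : ℝ => f t) p (wMeas ν Set.univ) + 1)) with hA
  have hAt : A ≠ ⊤ := by
    refine ENNReal.mul_ne_top ENNReal.ofReal_ne_top (ENNReal.mul_ne_top (ENNReal.LpAddConst_lt_top p).ne ?_)
    simp [hfin]
  refine ⟨A.toReal + C, fun x => ?_⟩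
  have hev := herr.eventually (gt_mem_nhds (show (0:ℝ≥0∞) < 1 by norm_num))
  obtain ⟨n, h1, h2, h3⟩ := (hev.and ((eventually_gt_atTop 0).and
    ((tendsto_natCast_atTop_atTop (R := ℝ)).eventually_ge_atTop (2 * |x|)))).exists
  have hn1 : (1:ℝ) ≤ n := by exact_mod_cast h2
  have hx : |x| ≤ n := by linarith [abs_nonneg x]
  have hPx : ‖(G n).eval (x:ℂ)‖ₑ ≤ A := by
    refine (hK n hn1 (G n) ?_ x (by linarith)).trans ?_
    · have := (hG n h2).1
      have : ((G n).natDegree : ℝ) ≤ D * n := by exact_mod_cast this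
      nlinarith
    · rw [hA]
      gcongr
      have e : (fun t : ℝ => (G n).eval (t:ℂ)) = (fun t : ℝ => f t) + fun t : ℝ => -(f t - (G n).eval (t:ℂ)) := by
        ext t; simp
      have hfc : Continuous fun t : ℝ => f t := hf.continuous.comp Complex.continuous_ofReal
      have hGc : Continuous fun t : ℝ => (G n).eval (t:ℂ) :=
        (G n).continuous.comp Complex.continuous_ofReal
      rw [e]
      refine (eLpNorm_add_le' hfc.aestronglyMeasurable
        (hfc.sub hGc).neg.aestronglyMeasurable p).trans ?_
      gcongr
      · exact wMeas_mono ν (Set.subset_univ _)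
      · have := eLpNorm_neg (fun t : ℝ => f t - (G n).eval (t:ℂ)) p (wMeas ν (Set.Icc (-(n:ℝ)) n))
        change eLpNorm (-(fun t : ℝ => f t - (G n).eval (t:ℂ))) _ _ ≤ 1
        rw [this]; exact h1.le
  have hPx' : ‖(G n).eval (x:ℂ)‖ ≤ A.toReal := by
    rw [← toReal_enorm]; exact ENNReal.toReal_mono hAt hPx
  have h4 := (hG n h2).2 x (by simpa using hx)
  have h5 : Real.exp (-(1 * (n:ℝ))) ≤ 1 := by rw [Real.exp_le_one_iff]; linarith
  have h6 : C * Real.exp (-(1 * (n:ℝ))) ≤ C := mul_le_of_le_one_right hC0 h5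
  calc ‖f x‖ = ‖(G n).eval (x:ℂ) + (f x - (G n).eval (x:ℂ))‖ := by congr 1; ring
    _ ≤ _ := (norm_add_le _ _).trans (by linarith)

lemma pl_upper (f : ℂ → ℂ) (hf : Differentiable ℂ f) (C σ M : ℝ) (hσ : 0 ≤ σ)
    (hC : ∀ z, ‖f z‖ ≤ C * Real.exp (σ * ‖z‖)) (hM : ∀ x : ℝ, ‖f x‖ ≤ M) (z : ℂ) (hz : 0 ≤ z.im) :
    ‖f z‖ ≤ max C M * Real.exp (σ * z.im) := by
  have hC0 : 0 ≤ C := by have := (norm_nonneg _).trans (hC 0); simpa using this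
  set h : ℂ → ℂ := fun z => f z * Complex.exp (σ * Complex.I * z) with hh
  have hn : ∀ w, ‖h w‖ = ‖f w‖ * Real.exp (-(σ * w.im)) := by
    intro w; rw [hh]; simp [Complex.norm_exp]
  have hd : Differentiable ℂ h := hf.mul (by fun_prop)
  have hO : ∀ S : Set ℂ, ∃ c < (2 : ℝ), ∃ B,
      h =O[Bornology.cobounded ℂ ⊓ 𝓟 S] fun z => Real.exp (B * ‖z‖ ^ c) := by
    intro S
    refine ⟨1, by norm_num, 2 * σ, ?_⟩
    refine Asymptotics.IsBigO.of_bound C (Eventually.of_forall fun w => ?_)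
    rw [hn, Real.rpow_one, Real.norm_of_nonneg (Real.exp_pos _).le]
    calc _ ≤ (C * Real.exp (σ * ‖w‖)) * Real.exp (σ * ‖w‖) := by
          gcongr
          · exact hC w
          · have := (abs_le.1 (Complex.abs_im_le_norm w)).1
            nlinarith
      _ = _ := by rw [mul_assoc, ← Real.exp_add]; ring_nf
  have hre : ∀ x : ℝ, ‖h x‖ ≤ max C M := by
    intro x; rw [hn]; simp; exact Or.inr (hM x)
  have him : ∀ x : ℝ, 0 ≤ x → ‖h (x * Complex.I)‖ ≤ max C M := by
    intro x hx
    rw [hn]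
    refine le_trans ?_ (le_max_left C M)
    calc _ ≤ (C * Real.exp (σ * ‖(x * Complex.I : ℂ)‖)) * Real.exp (-(σ * (x * Complex.I : ℂ).im)) := by
          gcongr; exact hC _
      _ = C := by rw [mul_assoc, ← Real.exp_add]; simp [abs_of_nonneg hx]
  have hfin : ‖h z‖ ≤ max C M := by
    rcases le_total 0 z.re with h1 | h1
    · exact PhragmenLindelof.quadrant_I hd.diffContOnCl (hO _) (fun x _ => hre x) him h1 hz
    · exact PhragmenLindelof.quadrant_II hd.diffContOnCl (hO _) (fun x _ => hre x) him h1 hz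
  rw [hn, Real.exp_neg, ← div_eq_mul_inv, div_le_iff₀ (Real.exp_pos _)] at hfin
  exact hfin

lemma pl_even (f : ℂ → ℂ) (hf : Differentiable ℂ f) (he : ∀ z, f (-z) = f z) (C σ M : ℝ) (hσ : 0 ≤ σ)
    (hC : ∀ z, ‖f z‖ ≤ C * Real.exp (σ * ‖z‖)) (hM : ∀ x : ℝ, ‖f x‖ ≤ M) (z : ℂ) :
    ‖f z‖ ≤ max C M * Real.exp (σ * |z.im|) := by
  rcases le_total 0 z.im with h | h
  · rw [abs_of_nonneg h]; exact pl_upper f hf C σ M hσ hC hM z h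
  · rw [abs_of_nonpos h, ← he]
    have := pl_upper f hf C σ M hσ hC hM (-z) (by simpa using h)
    simpa using this


lemma tc_unique (f : ℂ → ℂ) (hf : Differentiable ℂ f) (a : ℕ → ℂ)
    (h : ∀ z, HasSum (fun k => a k * z ^ k) (f z)) (k : ℕ) : tc f k = a k := by
  have h1 := (hf.analyticAt 0).hasFPowerSeriesAt
  have h2 : HasFPowerSeriesAt f (FormalMultilinearSeries.ofScalars ℂ a) 0 := by
    rw [hasFPowerSeriesAt_iff]
    refine Eventually.of_forall fun z => ?_
    simpa [FormalMultilinearSeries.coeff_ofScalars, mul_comm] using h z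
  have h3 := congrArg (fun s => FormalMultilinearSeries.coeff s k) (h1.eq_formalMultilinearSeries h2)
  simp only [FormalMultilinearSeries.coeff_ofScalars] at h3
  rw [tc, ← h3]; ring

lemma series_entire (f : ℂ → ℂ) (a : ℕ → ℂ) (h : ∀ z, HasSum (fun k => a k * z ^ k) (f z)) :
    Differentiable ℂ f := by
  intro z
  set R : ℝ := ‖z‖ + 1
  have hR : 0 < R := by positivity
  have hs : Summable fun k => ‖a k‖ * R ^ k := by
    have := (h R).summable.norm
    simpa [abs_of_pos hR] using this
  have hd : DifferentiableOn ℂ (fun w => ∑' k, a k * w ^ k) (Metric.ball 0 R) := by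
    refine Complex.differentiableOn_tsum_of_summable_norm hs (fun i => by fun_prop) Metric.isOpen_ball ?_
    intro i w hw
    rw [norm_mul, norm_pow]
    have : ‖w‖ ≤ R := by simpa using (Metric.mem_ball.1 hw).le
    gcongr
  have e : (fun w => ∑' k, a k * w ^ k) = f := funext fun w => (h w).tsum_eq
  rw [e] at hd
  exact hd.differentiableAt (Metric.isOpen_ball.mem_nhds (by simp [R]))

lemma tc_zero (f : ℂ → ℂ) : tc f 0 = f 0 := by simp [tc]

lemma tc_deriv (f : ℂ → ℂ) (k : ℕ) : tc (deriv f) k = (k+1) * tc f (k+1) := by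
  rw [tc, tc, iteratedDeriv_succ', Nat.factorial_succ]
  have : (k.factorial : ℂ) ≠ 0 := by exact_mod_cast k.factorial_ne_zero
  have : (k + 1 : ℂ) ≠ 0 := by exact_mod_cast k.succ_ne_zero
  push_cast
  field_simp

lemma entire_deriv {f : ℂ → ℂ} (hf : Differentiable ℂ f) : Differentiable ℂ (deriv f) := by
  have := (hf.contDiff (n := 2))
  exact this.differentiable_deriv_two

lemma dslope_hasSum (f : ℂ → ℂ) (hf : Differentiable ℂ f) (z : ℂ) :
    HasSum (fun k => tc f (k+1) * z ^ k) (dslope f 0 z) := by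
  by_cases hz : z = 0
  · subst hz
    have : dslope f 0 0 = tc f (0+1) * 0 ^ 0 := by simp [tc]
    rw [this]
    exact hasSum_single 0 (fun k hk => by simp [hk])
  · rw [dslope_of_ne _ hz, slope_def_field]
    have h := (hasSum_nat_add_iff' 1).2 (tc_hasSum f hf z)
    have h2 := h.div_const z
    simp only [Finset.range_one, Finset.sum_singleton, pow_zero, mul_one, tc_zero] at h2
    rw [sub_zero]
    have e : (fun k => tc f (k+1) * z ^ k) = fun k => tc f (k+1) * z ^ (k+1) / z := by
      ext k; field_simp; ring
    rw [e]; exact h2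

lemma dslope_entire (f : ℂ → ℂ) (hf : Differentiable ℂ f) : Differentiable ℂ (dslope f 0) :=
  series_entire _ _ (dslope_hasSum f hf)

lemma tc_dslope (f : ℂ → ℂ) (hf : Differentiable ℂ f) (k : ℕ) : tc (dslope f 0) k = tc f (k+1) :=
  tc_unique _ (dslope_entire f hf) _ (dslope_hasSum f hf) k

lemma deriv_even {f : ℂ → ℂ} (he : ∀ z, f (-z) = f z) (z : ℂ) : deriv f (-z) = - deriv f z := by
  have h := deriv_comp_neg f z
  have e : (fun x => f (-x)) = f := funext he
  rw [e] at h; rw [h, neg_neg]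

lemma deriv_even_zero {f : ℂ → ℂ} (he : ∀ z, f (-z) = f z) : deriv f 0 = 0 := by
  have h := deriv_even he 0
  rw [neg_zero] at h
  exact self_eq_neg.1 h

lemma bessel_eq (ν : ℝ) (f : ℂ → ℂ) (he : ∀ z, f (-z) = f z) :
    besselOp ν f = fun z => deriv (deriv f) z + (2*ν+1) * dslope (deriv f) 0 z := by
  ext z
  by_cases hz : z = 0
  · subst hz; simp [besselOp]; ring
  · simp [besselOp, hz, dslope_of_ne _ hz, slope_def_field, deriv_even_zero he]

lemma bessel_entire (ν : ℝ) {f : ℂ → ℂ} (hf : Differentiable ℂ f) (he : ∀ z, f (-z) = f z) :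
    Differentiable ℂ (besselOp ν f) := by
  rw [bessel_eq ν f he]
  exact (entire_deriv (entire_deriv hf)).add ((dslope_entire _ (entire_deriv hf)).const_mul _)

lemma bessel_even (ν : ℝ) {f : ℂ → ℂ} (he : ∀ z, f (-z) = f z) (z : ℂ) :
    besselOp ν f (-z) = besselOp ν f z := by
  have h2 : deriv (deriv f) (-z) = deriv (deriv f) z := by
    have h := deriv_comp_neg (deriv f) z
    have e : (fun x => deriv f (-x)) = fun x => - deriv f x := funext (deriv_even he)
    rw [e, deriv.fun_neg] at h
    exact (neg_injective h).symm
  by_cases hz : z = 0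
  · subst hz; simp
  · simp [besselOp, hz, deriv_even he, h2]

lemma tc_add {f g : ℂ → ℂ} (hf : Differentiable ℂ f) (hg : Differentiable ℂ g) (c : ℂ) (k : ℕ) :
    tc (fun z => f z + c * g z) k = tc f k + c * tc g k := by
  refine tc_unique (fun z => f z + c * g z) (hf.add (hg.const_mul c)) (fun k => tc f k + c * tc g k) (fun z => ?_) k
  have := (tc_hasSum f hf z).add ((tc_hasSum g hg z).mul_left c)
  have e : (fun k => (tc f k + c * tc g k) * z ^ k) = fun k => tc f k * z ^ k + c * (tc g k * z ^ k) := by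
    ext k; ring
  rw [e]; exact this

lemma tc_bessel (ν : ℝ) {f : ℂ → ℂ} (hf : Differentiable ℂ f) (he : ∀ z, f (-z) = f z) (k : ℕ) :
    tc (besselOp ν f) k = ((k+2) * (k+2+2*ν) : ℝ) * tc f (k+2) := by
  rw [bessel_eq ν f he, tc_add (entire_deriv (entire_deriv hf)) (dslope_entire _ (entire_deriv hf)),
    tc_dslope _ (entire_deriv hf), tc_deriv, tc_deriv]
  push_cast
  ring

lemma bessel_iter (ν : ℝ) (N : ℕ) : ∀ {f : ℂ → ℂ}, Differentiable ℂ f → (∀ z, f (-z) = f z) →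
    Differentiable ℂ ((besselOp ν)^[N] f) ∧ ∀ z, (besselOp ν)^[N] f (-z) = (besselOp ν)^[N] f z := by
  induction N with
  | zero => intro f hf he; exact ⟨hf, he⟩
  | succ N ih =>
    intro f hf he
    rw [Function.iterate_succ_apply]
    exact ih (bessel_entire ν hf he) (bessel_even ν he)

lemma bessel_L (ν : ℝ) (hν : -(1/2) ≤ ν) (N : ℕ) : ∃ b : ℝ, 0 < b ∧ ∀ {f : ℂ → ℂ}, Differentiable ℂ f →
    (∀ z, f (-z) = f z) → (besselOp ν)^[N] f 0 = b * tc f (2*N) := by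
  induction N with
  | zero => exact ⟨1, one_pos, fun {f} _ _ => by simp [tc_zero]⟩
  | succ N ih =>
    obtain ⟨b, hb, ih⟩ := ih
    refine ⟨b * (((2*N:ℕ)+2) * ((2*N:ℕ)+2+2*ν)), ?_, ?_⟩
    · have : (0:ℝ) < ((2*N:ℕ)+2+2*ν) := by
        have : (0:ℝ) ≤ (2*N:ℕ) := by positivity
        linarith
      positivity
    · intro f hf he
      rw [Function.iterate_succ_apply, ih (bessel_entire ν hf he) (bessel_even ν he), tc_bessel ν hf he,
        show 2 * N + 2 = 2 * (N+1) by ring]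
      push_cast
      ring

lemma bessel_smul (ν : ℝ) (a : ℂ) (f : ℂ → ℂ) :
    besselOp ν (fun z => a * f z) = fun z => a * besselOp ν f z := by
  ext z
  simp only [besselOp, deriv_const_mul_field']
  split_ifs <;> ring

lemma bessel_scale (ν : ℝ) (c : ℂ) (hc : c ≠ 0) (f : ℂ → ℂ) :
    besselOp ν (fun z => f (c * z)) = fun z => c ^ 2 * besselOp ν f (c * z) := by
  have h1 : ∀ g : ℂ → ℂ, deriv (fun z => g (c * z)) = fun z => c * deriv g (c * z) := by
    intro g; ext z; rw [deriv_comp_mul_left]; rfl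
  ext z
  simp only [besselOp, h1, deriv_const_mul_field']
  by_cases hz : z = 0
  · simp [hz]; ring
  · simp [hz, hc]; field_simp

lemma bessel_iter_smul (ν : ℝ) (a : ℂ) (N : ℕ) (f : ℂ → ℂ) :
    (besselOp ν)^[N] (fun z => a * f z) = fun z => a * (besselOp ν)^[N] f z := by
  induction N with
  | zero => rfl
  | succ N ih => rw [Function.iterate_succ_apply', ih, bessel_smul, Function.iterate_succ_apply']

lemma bessel_iter_scale (ν : ℝ) (c : ℂ) (hc : c ≠ 0) (N : ℕ) (f : ℂ → ℂ) :
    (besselOp ν)^[N] (fun z => f (c * z)) = fun z => c ^ (2*N) * (besselOp ν)^[N] f (c * z) := by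
  induction N with
  | zero => simp
  | succ N ih =>
    rw [Function.iterate_succ_apply', ih, bessel_smul, bessel_scale ν c hc, Function.iterate_succ_apply']
    ext z; ring

/-- bounded on horizontal strips -/
def SB (f : ℂ → ℂ) : Prop := ∀ h : ℝ, ∃ M : ℝ, ∀ z : ℂ, |z.im| ≤ h → ‖f z‖ ≤ M

lemma SB_deriv {f : ℂ → ℂ} (hf : Differentiable ℂ f) (hs : SB f) : SB (deriv f) := by
  intro h
  obtain ⟨M, hM⟩ := hs (h+1)
  refine ⟨M, fun z hz => ?_⟩
  have := Complex.norm_deriv_le_of_forall_mem_sphere_norm_le (c := z) one_pos hf.diffContOnCl (C := M) ?_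
  · simpa using this
  · intro w hw
    apply hM
    have h1 : |(w - z).im| ≤ 1 := (Complex.abs_im_le_norm _).trans (by simpa [dist_eq_norm] using hw.le)
    have : w.im = (w-z).im + z.im := by simp
    rw [this]; exact (abs_add_le _ _).trans (by linarith)

lemma SB_dslope {f : ℂ → ℂ} (hf : Differentiable ℂ f) (hs : SB f) : SB (dslope f 0) := by
  intro h
  obtain ⟨M, hM⟩ := hs h
  obtain ⟨M', hM'⟩ := (isCompact_closedBall (0:ℂ) 1).exists_bound_of_continuousOn
    (dslope_entire f hf).continuous.continuousOn
  refine ⟨max M' (M + ‖f 0‖), fun z hz => ?_⟩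
  by_cases h1 : ‖z‖ ≤ 1
  · exact (hM' z (by simpa using h1)).trans (le_max_left _ _)
  · push Not at h1
    refine le_trans ?_ (le_max_right _ _)
    have hz0 : z ≠ 0 := by rintro rfl; simp at h1; linarith
    rw [dslope_of_ne _ hz0, slope_def_field, sub_zero, norm_div]
    calc _ ≤ ‖f z - f 0‖ := div_le_self (norm_nonneg _) h1.le
      _ ≤ ‖f z‖ + ‖f 0‖ := norm_sub_le _ _
      _ ≤ _ := by gcongr; exact hM z hz

lemma SB_bessel (ν : ℝ) {f : ℂ → ℂ} (hf : Differentiable ℂ f) (he : ∀ z, f (-z) = f z) (hs : SB f) :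
    SB (besselOp ν f) := by
  rw [bessel_eq ν f he]
  intro h
  obtain ⟨M1, h1⟩ := SB_deriv (entire_deriv hf) (SB_deriv hf hs) h
  obtain ⟨M2, h2⟩ := SB_dslope (entire_deriv hf) (SB_deriv hf hs) h
  refine ⟨M1 + ‖(2*ν+1 : ℂ)‖ * M2, fun z hz => (norm_add_le _ _).trans ?_⟩
  rw [norm_mul]
  gcongr
  · exact h1 z hz
  · exact h2 z hz

lemma SB_bessel_iter (ν : ℝ) (N : ℕ) : ∀ {f : ℂ → ℂ}, Differentiable ℂ f → (∀ z, f (-z) = f z) → SB f →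
    SB ((besselOp ν)^[N] f) := by
  induction N with
  | zero => intro f _ _ h; exact h
  | succ N ih =>
    intro f hf he hs
    rw [Function.iterate_succ_apply]
    exact ih (bessel_entire ν hf he) (bessel_even ν he) (SB_bessel ν hf he hs)


lemma wMeas_scale (ν : ℝ) (c : ℝ) (hc : 0 < c) (s : Set ℝ) (hs : MeasurableSet s) :
    wMeas ν s = ENNReal.ofReal (c ^ (2*ν+2)) • Measure.map (c * ·) (wMeas ν ((c * ·) ⁻¹' s)) := by
  have hm : Measurable (c * · : ℝ → ℝ) := measurable_const_mul c
  ext A hA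
  rw [Measure.smul_apply, Measure.map_apply hm hA, wMeas, wMeas, withDensity_apply _ hA,
    withDensity_apply _ (hm hA), Measure.restrict_restrict hA, Measure.restrict_restrict (hm hA),
    ← Set.preimage_inter, ← lintegral_indicator (hA.inter hs), ← lintegral_indicator (hm (hA.inter hs))]
  set F : ℝ → ℝ≥0∞ := (A ∩ s).indicator fun t => ENNReal.ofReal (|t| ^ (2*ν+1)) with hF
  have hFm : Measurable F := (wMeas_meas _).indicator (hA.inter hs)
  calc ∫⁻ t, F t = ∫⁻ t, F t ∂(ENNReal.ofReal |c| • Measure.map (c * ·) volume) := by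
        rw [Real.smul_map_volume_mul_left hc.ne']
    _ = ENNReal.ofReal c * ∫⁻ t, F (c * t) := by
        rw [lintegral_smul_measure, lintegral_map hFm hm, abs_of_pos hc, smul_eq_mul]
    _ = _ := by
        have e : ∀ t, F (c * t) = ENNReal.ofReal (c ^ (2*ν+1)) *
            ((c * ·) ⁻¹' (A ∩ s)).indicator (fun t => ENNReal.ofReal (|t| ^ (2*ν+1))) t := by
          intro t
          by_cases h : c * t ∈ A ∩ s
          · rw [hF, Set.indicator_of_mem h, Set.indicator_of_mem (by exact h), ← ENNReal.ofReal_mul (by positivity), abs_mul, abs_of_pos hc,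
              Real.mul_rpow hc.le (abs_nonneg _)]
          · rw [hF, Set.indicator_of_notMem h, Set.indicator_of_notMem (by exact h), mul_zero]
        simp only [e]
        rw [lintegral_const_mul _ ((wMeas_meas _).indicator (hm (hA.inter hs))), ← mul_assoc,
          ← ENNReal.ofReal_mul hc.le, smul_eq_mul]
        have e3 : c ^ (2*ν+2) = c * c ^ (2*ν+1) := by
          rw [show 2*ν+2 = 1 + (2*ν+1) by ring, Real.rpow_add hc, Real.rpow_one]
        rw [e3]

lemma eLp_scale (ν : ℝ) (p : ℝ≥0∞) (c : ℝ) (hc : 0 < c) (s : Set ℝ) (hs : MeasurableSet s) (g : ℝ → ℂ) :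
    eLpNorm g p (wMeas ν s) = ENNReal.ofReal (c ^ ((2*ν+2)/p.toReal)) *
      eLpNorm (fun t => g (c * t)) p (wMeas ν ((c * ·) ⁻¹' s)) := by
  have he : MeasurableEmbedding (c * · : ℝ → ℝ) := measurableEmbedding_mulLeft₀ hc.ne'
  rw [wMeas_scale ν c hc s hs, eLpNorm_smul_measure_of_ne_zero (by simpa using by positivity),
    he.eLpNorm_map_measure, smul_eq_mul]
  congr 1
  rw [ENNReal.ofReal_rpow_of_pos (by positivity), ← Real.rpow_mul hc.le]
  simp [div_eq_mul_inv]

/-- the quotient -/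
def rat (ν : ℝ) (N : ℕ) (p : ℝ≥0∞) (s : Set ℝ) (f : ℂ → ℂ) : ℝ≥0∞ :=
  (‖(besselOp ν)^[N] f 0‖₊ : ℝ≥0∞) / eLpNorm (fun t : ℝ => f t) p (wMeas ν s)

lemma ofReal_cancel (a : ℝ) (ha : 0 < a) (x : ℝ≥0∞) : ENNReal.ofReal a⁻¹ * (ENNReal.ofReal a * x) = x := by
  rw [← mul_assoc, ← ENNReal.ofReal_mul (by positivity), inv_mul_cancel₀ ha.ne']; simp

lemma ratio_aux (a b : ℝ) (ha : 0 < a) (hb : 0 < b) (x y : ℝ≥0∞) :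
    ENNReal.ofReal a * x / y = ENNReal.ofReal (a * b) * (x / (ENNReal.ofReal b * y)) := by
  rw [ENNReal.ofReal_mul ha.le]
  have hb1 : ENNReal.ofReal b ≠ 0 := by simpa using hb
  have hb2 : ENNReal.ofReal b ≠ ⊤ := ENNReal.ofReal_ne_top
  rw [div_eq_mul_inv, div_eq_mul_inv, ENNReal.mul_inv (Or.inl hb1) (Or.inl hb2)]
  calc _ = ENNReal.ofReal a * (ENNReal.ofReal b * (ENNReal.ofReal b)⁻¹) * (x * y⁻¹) := by
        rw [ENNReal.mul_inv_cancel hb1 hb2]; ring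
    _ = _ := by ring

lemma rat_scale (ν : ℝ) (N : ℕ) (p : ℝ≥0∞) (c : ℝ) (hc : 0 < c) (s : Set ℝ) (hs : MeasurableSet s) (f : ℂ → ℂ) :
    rat ν N p ((c * ·) ⁻¹' s) (fun z => f (c * z)) =
      ENNReal.ofReal (c ^ (2 * (N:ℝ) + (2*ν+2)/p.toReal)) * rat ν N p s f := by
  rw [rat, rat, bessel_iter_scale ν c (by exact_mod_cast hc.ne'),
    eLp_scale ν p c hc s hs (fun t : ℝ => f t), Real.rpow_add hc]
  rw [← ratio_aux _ _ (by positivity) (by positivity)]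
  congr 1
  · rw [nnnorm_mul, ENNReal.coe_mul, mul_zero]
    congr 1
    rw [← ENNReal.ofReal_coe_nnreal]; simp only [coe_nnnorm, norm_pow, Complex.norm_real, Real.norm_of_nonneg hc.le]
    rw [← Real.rpow_natCast]; push_cast; rfl
  · simp

lemma preimage_Icc_n (n : ℕ) (hn : 0 < n) : ((n:ℝ) * ·) ⁻¹' (Set.Icc (-(n:ℝ)) n) = Set.Icc (-1) 1 := by
  have : (0:ℝ) < n := by exact_mod_cast hn
  ext t
  simp only [Set.mem_preimage, Set.mem_Icc]
  constructor
  · rintro ⟨h1, h2⟩; constructor <;> nlinarith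
  · rintro ⟨h1, h2⟩; constructor <;> nlinarith

/-- normalised constant -/
def cN (ν : ℝ) (N : ℕ) (p : ℝ≥0∞) (n : ℕ) : ℝ≥0∞ :=
  ENNReal.ofReal ((n : ℝ) ^ (-(2 * (N : ℝ)) - (2 * ν + 2) / p.toReal)) * polyConst ν N p n

lemma rat_n (ν : ℝ) (N : ℕ) (p : ℝ≥0∞) (n : ℕ) (hn : 0 < n) (f : ℂ → ℂ) :
    ENNReal.ofReal ((n : ℝ) ^ (-(2 * (N : ℝ)) - (2 * ν + 2) / p.toReal)) *
      rat ν N p (Set.Icc (-1) 1) (fun z => f (n * z)) = rat ν N p (Set.Icc (-(n:ℝ)) n) f := by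
  have h0 : (0:ℝ) < n := by exact_mod_cast hn
  have h := rat_scale ν N p n h0 (Set.Icc (-(n:ℝ)) n) measurableSet_Icc f
  rw [preimage_Icc_n n hn] at h
  simp only [Complex.ofReal_natCast] at h
  rw [h, show (-(2 * (N : ℝ)) - (2 * ν + 2) / p.toReal) = -(2 * (N:ℝ) + (2*ν+2)/p.toReal) by ring,
    Real.rpow_neg h0.le, ofReal_cancel _ (by positivity)]

lemma rat_le_cN (ν : ℝ) (N : ℕ) (p : ℝ≥0∞) (n : ℕ) (hn : 0 < n) (P : Polynomial ℂ)
    (hd : P.natDegree ≤ 2 * (n/2)) (he : ∀ z, P.eval (-z) = P.eval z) (h0 : P ≠ 0) :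
    rat ν N p (Set.Icc (-(n:ℝ)) n) (fun z => P.eval z) ≤ cN ν N p n := by
  have hnc : (n:ℂ) ≠ 0 := by exact_mod_cast hn.ne'
  rw [← rat_n ν N p n hn, cN]
  gcongr
  have hq : ∀ z, (P.comp (C (n:ℂ) * X)).eval z = P.eval (n * z) := by intro z; simp
  have h := le_iSup₂ (f := fun (Q : Polynomial ℂ)
    (_ : Q.natDegree ≤ 2 * (n / 2) ∧ (∀ z : ℂ, Q.eval (-z) = Q.eval z) ∧ Q ≠ 0) =>
    (‖(besselOp ν)^[N] (fun z => Q.eval z) 0‖₊ : ℝ≥0∞) /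
      eLpNorm (fun t : ℝ => Q.eval (t : ℂ)) p (wMeas ν (Set.Icc (-1 : ℝ) 1))) (P.comp (C (n:ℂ) * X)) ⟨?_, ?_, ?_⟩
  · simp only [hq] at h; exact h
  · rw [natDegree_comp, natDegree_C_mul_X _ hnc]; simpa using hd
  · intro z; rw [hq, hq, mul_neg, he]
  · intro h
    apply h0
    apply Polynomial.funext
    intro r
    have := hq (r / n)
    rw [h, mul_div_cancel₀ _ hnc] at this
    rw [← this]; simp

lemma exists_of_lt_cN (ν : ℝ) (N : ℕ) (p : ℝ≥0∞) (n : ℕ) (hn : 0 < n) (a : ℝ≥0∞) (ha : a < cN ν N p n) :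
    ∃ P : Polynomial ℂ, P.natDegree ≤ n ∧ (∀ z, P.eval (-z) = P.eval z) ∧
      a < rat ν N p (Set.Icc (-(n:ℝ)) n) (fun z => P.eval z) := by
  have hnc : (n:ℂ) ≠ 0 := by exact_mod_cast hn.ne'
  rw [cN, polyConst] at ha
  simp only [ENNReal.mul_iSup] at ha
  rw [lt_iSup_iff] at ha
  obtain ⟨Q, ha⟩ := ha
  rw [lt_iSup_iff] at ha
  obtain ⟨⟨h1, h2, h3⟩, ha⟩ := ha
  have hq : ∀ z, (Q.comp (C (n:ℂ)⁻¹ * X)).eval z = Q.eval ((n:ℂ)⁻¹ * z) := by intro z; simp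
  refine ⟨Q.comp (C (n:ℂ)⁻¹ * X), ?_, ?_, ?_⟩
  · rw [natDegree_comp, natDegree_C_mul_X _ (inv_ne_zero hnc)]; omega
  · intro z; rw [hq, hq, mul_neg, h2]
  · rw [← rat_n ν N p n hn]
    simp only [hq, inv_mul_cancel_left₀ hnc]
    exact ha


lemma cheb_span (P : Polynomial ℂ) :
    P ∈ Submodule.span ℂ (Set.range fun k : ℕ => Chebyshev.T ℂ (k:ℤ)) := by
  set S := Submodule.span ℂ (Set.range fun k : ℕ => Chebyshev.T ℂ (k:ℤ)) with hS
  have hT : ∀ k : ℤ, Chebyshev.T ℂ k ∈ S := by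
    intro k
    rw [← Chebyshev.T_natAbs]
    exact Submodule.subset_span ⟨_, rfl⟩
  have hX : ∀ Q ∈ S, X * Q ∈ S := by
    intro Q hQ
    induction hQ using Submodule.span_induction with
    | mem x h =>
      obtain ⟨k, rfl⟩ := h
      have h := Chebyshev.T_mul_T ℂ 1 k
      rw [Chebyshev.T_one] at h
      have : X * Chebyshev.T ℂ (k:ℤ) = (1/2 : ℂ) • (Chebyshev.T ℂ (1 + k) + Chebyshev.T ℂ (1 - k)) := by
        rw [← h, mul_assoc, ← Polynomial.C_ofNat 2, ← smul_eq_C_mul, smul_smul]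
        norm_num
      rw [this]
      exact S.smul_mem _ (S.add_mem (hT _) (hT _))
    | zero => simp
    | add x y _ _ h1 h2 => rw [mul_add]; exact S.add_mem h1 h2
    | smul a x _ h => rw [mul_smul_comm]; exact S.smul_mem _ h
  have hXn : ∀ n : ℕ, (X ^ n : Polynomial ℂ) ∈ S := by
    intro n
    induction n with
    | zero => have := hT 0; rw [Chebyshev.T_zero] at this; simpa using this
    | succ n ih => rw [pow_succ']; exact hX _ ih
  rw [P.as_sum_range_C_mul_X_pow]
  refine S.sum_mem fun i _ => ?_
  rw [← smul_eq_C_mul]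
  exact S.smul_mem _ (hXn i)

lemma cheb_expand (P : Polynomial ℂ) : ∃ (m : ℕ) (a : ℕ → ℂ),
    P = ∑ k ∈ Finset.range (m+1), a k • Chebyshev.T ℂ (k:ℤ) := by
  obtain ⟨c, hc⟩ := (Finsupp.mem_span_range_iff_exists_finsupp).1 (cheb_span P)
  refine ⟨c.support.sup id, c, ?_⟩
  rw [← hc, Finsupp.sum]
  refine Finset.sum_subset ?_ ?_
  · intro k hk
    rw [Finset.mem_range, Nat.lt_succ_iff]
    exact Finset.le_sup (f := id) hk
  · intro k _ hk
    rw [Finsupp.notMem_support_iff.1 hk, zero_smul]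

lemma tc_poly (q : Polynomial ℂ) (k : ℕ) : tc (fun z => q.eval z) k = q.coeff k := by
  refine tc_unique (fun z => q.eval z) q.differentiable (fun k => q.coeff k) (fun z => ?_) k
  rw [eval_eq_sum_range]
  refine hasSum_sum_of_ne_finset_zero fun b hb => ?_
  rw [coeff_eq_zero_of_natDegree_lt, zero_mul]
  simpa using hb

lemma T_jouk (k : ℕ) (w : ℂ) (hw : w ≠ 0) :
    (Chebyshev.T ℂ (k:ℤ)).eval ((w + w⁻¹)/2) = (w^k + (w^k)⁻¹)/2 := by
  have h := Chebyshev.T_complex_cosh (Complex.log w) k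
  rw [Complex.cosh, Complex.cosh, Complex.exp_neg, Complex.exp_log hw, Complex.exp_neg] at h
  rw [h]
  push_cast
  rw [Complex.exp_nat_mul, Complex.exp_log hw]

lemma T_le_one (k : ℕ) (x : ℝ) (hx : |x| ≤ 1) : ‖(Chebyshev.T ℂ (k:ℤ)).eval (x:ℂ)‖ ≤ 1 := by
  have h : (x:ℂ) = Complex.cos (Real.arccos x) := by
    rw [← Complex.ofReal_cos, Real.cos_arccos (abs_le.1 hx).1 (abs_le.1 hx).2]
  rw [h, Chebyshev.T_complex_cos]
  have : (((k:ℤ):ℂ) * (Real.arccos x : ℝ)) = ((k * Real.arccos x : ℝ) : ℂ) := by push_cast; rfl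
  rw [this, ← Complex.ofReal_cos, Complex.norm_real]
  exact Real.abs_cos_le_one _

lemma cheb_coeff (m : ℕ) (a : ℕ → ℂ) (r M : ℝ) (hr : 0 < r)
    (hM : ∀ w : ℂ, ‖w‖ = r → ‖(∑ k ∈ Finset.range (m+1), a k • Chebyshev.T ℂ (k:ℤ)).eval ((w + w⁻¹)/2)‖ ≤ M)
    (k : ℕ) (hk : 1 ≤ k) (hkm : k ≤ m) : ‖a k‖ ≤ 2 * M / r ^ k := by
  set q : Polynomial ℂ := ∑ j ∈ Finset.range (m+1), C (a j / 2) * (X ^ (m+j) + X ^ (m-j)) with hq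
  have hqe : ∀ w : ℂ, w ≠ 0 → q.eval w =
      w ^ m * (∑ k ∈ Finset.range (m+1), a k • Chebyshev.T ℂ (k:ℤ)).eval ((w + w⁻¹)/2) := by
    intro w hw
    rw [hq, eval_finsetSum, eval_finsetSum, Finset.mul_sum]
    refine Finset.sum_congr rfl fun j hj => ?_
    have hj' : j ≤ m := by simp at hj; omega
    rw [eval_smul, T_jouk j w hw]
    simp only [eval_mul, eval_C, eval_add, eval_pow, eval_X, smul_eq_mul]
    rw [pow_add, pow_sub₀ w hw hj']; ring
  have hcoef : q.coeff (m+k) = a k / 2 := by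
    rw [hq, finsetSum_coeff, Finset.sum_eq_single k]
    · rw [coeff_C_mul, coeff_add, coeff_X_pow, coeff_X_pow, if_pos rfl, if_neg (by omega)]; ring
    · intro j hj hjk
      rw [coeff_C_mul, coeff_add, coeff_X_pow, coeff_X_pow, if_neg (by omega), if_neg (by omega)]; ring
    · intro h; simp at h; omega
  have hb := tc_bound (fun z => q.eval z) q.differentiable r (r ^ m * M) hr (fun z hz => by
    have hz0 : z ≠ 0 := by rw [← norm_pos_iff, hz]; exact hr
    simp only [hqe z hz0]
    rw [norm_mul, norm_pow, hz]
    gcongr; exact hM z hz) (m+k)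
  rw [tc_poly, hcoef, pow_add, mul_div_mul_left _ _ (by positivity), norm_div] at hb
  simp at hb
  rw [mul_div_assoc]; linarith

lemma cheb_trunc (P : Polynomial ℂ) (n : ℕ) (r M : ℝ) (hr : 1 < r)
    (hM : ∀ w : ℂ, ‖w‖ = r → ‖P.eval ((w + w⁻¹)/2)‖ ≤ M) :
    ∃ Q : Polynomial ℂ, Q.natDegree ≤ n ∧ ∀ x : ℝ, |x| ≤ 1 →
      ‖P.eval (x:ℂ) - Q.eval (x:ℂ)‖ ≤ 2 * M / (r - 1) * (r⁻¹) ^ n := by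
  obtain ⟨m, a, rfl⟩ := cheb_expand P
  have hM0 : 0 ≤ M := (norm_nonneg _).trans (hM r (by simp; linarith))
  refine ⟨∑ k ∈ (Finset.range (m+1)).filter (fun k => k ≤ n), a k • Chebyshev.T ℂ (k:ℤ), ?_, ?_⟩
  · refine natDegree_sum_le_of_forall_le _ _ fun k hk => ?_
    refine (natDegree_smul_le _ _).trans ?_
    rw [Chebyshev.natDegree_T]
    simp at hk ⊢; omega
  · intro x hx
    rw [← eval_sub, ← Finset.sum_filter_add_sum_filter_not (Finset.range (m+1)) (fun k => k ≤ n),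
      add_sub_cancel_left, eval_finsetSum]
    have hg : HasSum (fun i : ℕ => 2 * M * r⁻¹ ^ (n+1) * r⁻¹ ^ i) (2 * M * r⁻¹ ^ (n+1) * (1 - r⁻¹)⁻¹) :=
      (hasSum_geometric_of_lt_one (by positivity) (inv_lt_one_of_one_lt₀ hr)).mul_left _
    calc _ ≤ ∑ k ∈ (Finset.range (m+1)).filter (fun k => ¬ k ≤ n), 2 * M * r⁻¹ ^ k := by
          refine norm_sum_le_of_le _ fun k hk => ?_
          simp at hk
          rw [eval_smul, norm_smul]
          have h1 := cheb_coeff m a r M (by linarith) hM k (by omega) (by omega)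
          have h2 := T_le_one k x hx
          calc _ ≤ 2 * M / r ^ k * 1 := by gcongr
            _ = _ := by rw [mul_one, inv_pow, div_eq_mul_inv]
      _ ≤ ∑ k ∈ Finset.Ico (n+1) (m+1+n+1), 2 * M * r⁻¹ ^ k := by
          refine Finset.sum_le_sum_of_subset_of_nonneg ?_ fun _ _ _ => by positivity
          intro k hk; simp at hk ⊢; omega
      _ = ∑ i ∈ Finset.range (m+1), 2 * M * r⁻¹ ^ (n+1) * r⁻¹ ^ i := by
          rw [Finset.sum_Ico_eq_sum_range]
          rw [show m + 1 + n + 1 - (n+1) = m + 1 by omega]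
          refine Finset.sum_congr rfl fun i _ => ?_
          rw [pow_add]; ring
      _ ≤ 2 * M * r⁻¹ ^ (n+1) * (1 - r⁻¹)⁻¹ := sum_le_hasSum _ (fun _ _ => by positivity) hg
      _ = _ := by
          have : r - 1 ≠ 0 := by linarith
          have : r ≠ 0 := by linarith
          rw [pow_succ]; field_simp


lemma exists_u (σ : ℝ) (hσ : σ < 1) : ∃ u : ℝ, 0 < u ∧ σ * Real.sinh u < u := by
  have h1 : HasDerivAt (fun u => u - σ * Real.sinh u) (1 - σ * Real.cosh 0) 0 :=
    (hasDerivAt_id 0).sub ((Real.hasDerivAt_sinh 0).const_mul σ)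
  rw [Real.cosh_zero, mul_one] at h1
  have h2 := (hasDerivAt_iff_tendsto_slope.1 h1).eventually (lt_mem_nhds (show (0:ℝ) < 1 - σ by linarith))
  have h3 : ∀ᶠ u in 𝓝[>] (0:ℝ), 0 < slope (fun u => u - σ * Real.sinh u) 0 u :=
    h2.filter_mono (nhdsWithin_mono _ (fun x hx => ne_of_gt hx))
  obtain ⟨u, hu, hu0⟩ := (h3.and self_mem_nhdsWithin).exists
  have hu0 : 0 < u := hu0
  refine ⟨u, hu0, ?_⟩
  rw [slope_def_field] at hu
  simp only [Real.sinh_zero, mul_zero, sub_zero] at hu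
  have := (div_pos_iff_of_pos_right hu0).1 hu
  linarith

lemma even_natDegree (P : Polynomial ℂ) (n : ℕ) (hd : P.natDegree ≤ n)
    (he : ∀ z, P.eval (-z) = P.eval z) : P.natDegree ≤ 2 * (n/2) := by
  have h : P.comp (-X) = P := by
    apply Polynomial.funext; intro z; simp [he]
  by_cases h0 : P = 0
  · simp [h0]
  have h1 : P.leadingCoeff = (-1) ^ P.natDegree * P.leadingCoeff := by
    conv_lhs => rw [← h]
    exact comp_neg_X_leadingCoeff_eq P
  have h2 : Even P.natDegree := by
    by_contra ho
    rw [Nat.not_even_iff_odd] at ho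
    rw [ho.neg_one_pow] at h1
    have : P.leadingCoeff = 0 := by
      have : (2:ℂ) * P.leadingCoeff = 0 := by linear_combination h1
      simpa using this
    exact h0 (leadingCoeff_eq_zero.1 this)
  obtain ⟨k, hk⟩ := h2
  omega

lemma jouk_im (w : ℂ) (u : ℝ) (hu : 0 ≤ u) (hw : ‖w‖ = Real.exp u) : |((w + w⁻¹)/2).im| ≤ Real.sinh u := by
  have hn : Complex.normSq w = Real.exp u ^ 2 := by rw [Complex.normSq_eq_norm_sq, hw]
  have e : ((w + w⁻¹)/2).im = w.im * ((1 - (Real.exp u ^ 2)⁻¹) / 2) := by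
    rw [show (2:ℂ) = ((2:ℝ):ℂ) by norm_num, Complex.div_ofReal_im]
    simp [Complex.inv_im, hn]; ring
  have hpos : 0 ≤ 1 - (Real.exp u ^ 2)⁻¹ := by
    have : 1 ≤ Real.exp u ^ 2 := one_le_pow₀ (Real.one_le_exp hu)
    have := inv_le_one_of_one_le₀ this
    linarith
  rw [e, abs_mul, abs_of_nonneg (by positivity : 0 ≤ (1 - (Real.exp u ^ 2)⁻¹) / 2)]
  calc _ ≤ Real.exp u * ((1 - (Real.exp u ^ 2)⁻¹) / 2) := by
        gcongr; rw [← hw]; exact Complex.abs_im_le_norm w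
    _ = Real.sinh u := by
        rw [Real.sinh_eq, Real.exp_neg]; field_simp

lemma jouk_norm (w : ℂ) (r : ℝ) (hr : 1 ≤ r) (hw : ‖w‖ = r) : ‖(w + w⁻¹)/2‖ ≤ r := by
  rw [norm_div]
  have h1 : ‖w⁻¹‖ ≤ r := by
    rw [norm_inv, hw]; exact (inv_le_one_of_one_le₀ hr).trans hr
  have := norm_add_le w w⁻¹
  simp only [Complex.norm_ofNat]
  linarith

lemma approx_poly (g : ℂ → ℂ) (hg : Differentiable ℂ g) (he : ∀ z, g (-z) = g z) (C₀ σ : ℝ) (hσ0 : 0 ≤ σ)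
    (hσ : σ < 1) (hC : ∀ z, ‖g z‖ ≤ C₀ * Real.exp (σ * |z.im|)) :
    ∃ (γ C' : ℝ), 0 < γ ∧ ∀ n : ℕ, 0 < n → ∃ P : Polynomial ℂ, P.natDegree ≤ 2 * (n/2) ∧
      (∀ z, P.eval (-z) = P.eval z) ∧
      (∀ t : ℝ, |t| ≤ n → ‖P.eval (t:ℂ) - g t‖ ≤ C' * Real.exp (-(γ * n))) ∧
      (∀ z : ℂ, ‖z‖ ≤ 1 → ‖P.eval z - g z‖ ≤ C' * Real.exp (-(γ * n))) := by
  have hC0 : 0 ≤ C₀ := by have := (norm_nonneg _).trans (hC 0); simpa using this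
  obtain ⟨u, hu, huσ⟩ := exists_u σ hσ
  set r := Real.exp u with hr
  have hr1 : 1 < r := Real.one_lt_exp_iff.2 hu
  set γ := min 1 (u - σ * Real.sinh u) with hγ
  have hγ0 : 0 < γ := lt_min one_pos (by linarith)
  set D : ℕ := ⌈Real.exp 1 * r⌉₊ + 1 with hD
  have hDB : Real.exp 1 * r + 1 ≤ D := by
    rw [hD]; push_cast; linarith [Nat.le_ceil (Real.exp 1 * r)]
  set C₁ := 4 * C₀ / (r - 1) with hC1
  have hC10 : 0 ≤ C₁ := div_nonneg (by positivity) (by linarith)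
  refine ⟨γ, C₀ + C₁ * Real.exp D, hγ0, fun n hn => ?_⟩
  have hnR : (0:ℝ) < n := by exact_mod_cast hn
  have hn1 : (1:ℝ) ≤ n := by exact_mod_cast hn
  have hnc : (n:ℂ) ≠ 0 := by exact_mod_cast hn.ne'
  obtain ⟨G, hG1, hG2⟩ := taylor_approx g hg (n * r) (C₀ * Real.exp (Real.exp 1 * (n * r))) (by positivity)
    (fun z hz => (hC z).trans (by
      refine mul_le_mul_of_nonneg_left (Real.exp_le_exp.2 ?_) hC0
      calc σ * |z.im| ≤ 1 * ‖z‖ := mul_le_mul hσ.le (Complex.abs_im_le_norm z) (abs_nonneg _) zero_le_one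
        _ ≤ _ := by rw [one_mul]; exact hz)) (D * n)
  have hG3 : ∀ z : ℂ, ‖z‖ ≤ n * r → ‖g z - G.eval z‖ ≤ C₀ * Real.exp (-(1 * n)) := by
    intro z hz
    refine (hG2 z hz).trans ?_
    rw [mul_assoc, ← Real.exp_add]
    gcongr
    push_cast
    nlinarith
  have hE1 : Real.exp (-(1 * (n:ℝ))) ≤ Real.exp (-(γ * n)) := by
    gcongr; exact min_le_left _ _
  -- bound on the ellipse
  have hGw : ∀ w : ℂ, ‖w‖ = r → ‖(G.comp (C (n:ℂ) * X)).eval ((w + w⁻¹)/2)‖ ≤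
      2 * C₀ * Real.exp (n * (σ * Real.sinh u)) := by
    intro w hw
    rw [eval_comp]
    simp only [eval_mul, eval_C, eval_X]
    set z : ℂ := n * ((w + w⁻¹)/2) with hz
    have hz1 : ‖z‖ ≤ n * r := by
      rw [hz, norm_mul, Complex.norm_natCast]; gcongr; exact jouk_norm w r hr1.le hw
    have hz2 : |z.im| ≤ n * Real.sinh u := by
      have : z.im = n * ((w + w⁻¹)/2).im := by
        rw [hz, ← Complex.ofReal_natCast, Complex.im_ofReal_mul]
      rw [this, abs_mul, abs_of_pos hnR]; gcongr; exact jouk_im w u hu.le hw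
    have h1 := hG3 z hz1
    have h2 : ‖g z‖ ≤ C₀ * Real.exp (n * (σ * Real.sinh u)) := (hC z).trans (by
      refine mul_le_mul_of_nonneg_left (Real.exp_le_exp.2 ?_) hC0
      have := mul_le_mul_of_nonneg_left hz2 hσ0
      linarith)
    have h3 : C₀ * Real.exp (-(1 * (n:ℝ))) ≤ C₀ * Real.exp (n * (σ * Real.sinh u)) := by
      gcongr
      have : 0 ≤ n * (σ * Real.sinh u) := mul_nonneg hnR.le (mul_nonneg hσ0 (Real.sinh_nonneg_iff.2 hu.le))
      linarith
    calc ‖G.eval z‖ = ‖g z - (g z - G.eval z)‖ := by congr 1; ring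
      _ ≤ _ := (norm_sub_le _ _).trans (by linarith)
  obtain ⟨Q, hQ1, hQ2⟩ := cheb_trunc _ n r _ hr1 hGw
  set P₀ := Q.comp (C (n:ℂ)⁻¹ * X) with hP0
  have hP0e : ∀ z, P₀.eval z = Q.eval ((n:ℂ)⁻¹ * z) := by intro z; rw [hP0]; simp
  have hP0d : P₀.natDegree ≤ n := by
    rw [hP0, natDegree_comp, natDegree_C_mul_X _ (inv_ne_zero hnc)]; simpa using hQ1
  have hdiff : ∀ t : ℝ, |t| ≤ n → ‖(G - P₀).eval (t:ℂ)‖ ≤ C₁ * Real.exp (-(γ * n)) := by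
    intro t ht
    have h := hQ2 (t / n) (by rw [abs_div, abs_of_pos hnR, div_le_one hnR]; exact ht)
    rw [eval_comp] at h
    simp only [eval_mul, eval_C, eval_X] at h
    push_cast at h
    rw [mul_div_cancel₀ _ hnc] at h
    rw [eval_sub, hP0e, ← div_eq_inv_mul]
    refine h.trans ?_
    have e : r⁻¹ ^ n = Real.exp (-(n * u)) := by
      rw [hr, ← Real.exp_neg, ← Real.exp_nat_mul]; congr 1; ring
    rw [e, hC1]
    calc _ = 4 * C₀ / (r - 1) * (Real.exp (n * (σ * Real.sinh u)) * Real.exp (-(n * u))) := by ring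
      _ ≤ _ := by
        rw [← Real.exp_add]
        gcongr
        have : γ ≤ u - σ * Real.sinh u := min_le_right _ _
        nlinarith
  have hdiffz : ∀ z : ℂ, ‖z‖ ≤ 1 → ‖(G - P₀).eval z‖ ≤ C₁ * Real.exp D * Real.exp (-(γ * n)) := by
    intro z hz
    have hD1 : 1 ≤ D := by omega
    have h := bernstein_growth (G - P₀) (D * n) ((natDegree_sub_le _ _).trans
      (max_le hG1 (hP0d.trans (Nat.le_mul_of_pos_left n hD1)))) _ n hnR hdiff z
    refine h.trans ?_
    have : ((D * n : ℕ):ℝ) * ‖z‖ / n ≤ D := by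
      push_cast; rw [div_le_iff₀ hnR]
      have : (D:ℝ) * n * ‖z‖ ≤ D * n * 1 := by gcongr
      linarith
    calc _ ≤ C₁ * Real.exp (-(γ * n)) * Real.exp D := by gcongr
      _ = _ := by ring
  have hD1 : (1:ℝ) ≤ Real.exp D := Real.one_le_exp (by positivity)
  -- errors for P₀
  have key : ∀ z : ℂ, ‖z‖ ≤ n * r → ‖(G - P₀).eval z‖ ≤ C₁ * Real.exp D * Real.exp (-(γ * n)) →
      ‖P₀.eval z - g z‖ ≤ (C₀ + C₁ * Real.exp D) * Real.exp (-(γ * n)) := by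
    intro z hz h
    have h1 := hG3 z hz
    rw [eval_sub] at h
    calc _ = ‖-(g z - G.eval z) - (G.eval z - P₀.eval z)‖ := by congr 1; ring
      _ ≤ ‖g z - G.eval z‖ + ‖G.eval z - P₀.eval z‖ := by
        refine (norm_sub_le _ _).trans ?_; rw [norm_neg]
      _ ≤ C₀ * Real.exp (-(γ * n)) + C₁ * Real.exp D * Real.exp (-(γ * n)) := by
        refine add_le_add (h1.trans (by gcongr)) h
      _ = _ := by ring
  have k1 : ∀ t : ℝ, |t| ≤ n → ‖P₀.eval (t:ℂ) - g t‖ ≤ (C₀ + C₁ * Real.exp D) * Real.exp (-(γ * n)) := by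
    intro t ht
    refine key t (by simp; nlinarith) ((hdiff t ht).trans ?_)
    gcongr
    exact le_mul_of_one_le_right hC10 hD1
  have k2 : ∀ z : ℂ, ‖z‖ ≤ 1 → ‖P₀.eval z - g z‖ ≤ (C₀ + C₁ * Real.exp D) * Real.exp (-(γ * n)) := by
    intro z hz
    exact key z (by nlinarith) (hdiffz z hz)
  -- symmetrise
  have hPe : ∀ z, (C (1/2 : ℂ) * (P₀ + P₀.comp (-X))).eval z = (P₀.eval z + P₀.eval (-z)) / 2 := by
    intro z; simp; ring
  have hev : ∀ z, (C (1/2 : ℂ) * (P₀ + P₀.comp (-X))).eval (-z) = (C (1/2 : ℂ) * (P₀ + P₀.comp (-X))).eval z := by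
    intro z; rw [hPe, hPe, neg_neg, add_comm]
  have hsym : ∀ (z : ℂ) (E : ℝ), ‖P₀.eval z - g z‖ ≤ E → ‖P₀.eval (-z) - g (-z)‖ ≤ E →
      ‖(C (1/2 : ℂ) * (P₀ + P₀.comp (-X))).eval z - g z‖ ≤ E := by
    intro z E h1 h2
    rw [he] at h2
    rw [hPe]
    calc _ = ‖((P₀.eval z - g z) + (P₀.eval (-z) - g z))/2‖ := by congr 1; ring
      _ ≤ _ := by
        rw [norm_div]
        have := norm_add_le (P₀.eval z - g z) (P₀.eval (-z) - g z)
        simp only [Complex.norm_ofNat]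
        linarith
  refine ⟨C (1/2 : ℂ) * (P₀ + P₀.comp (-X)), even_natDegree _ n ?_ hev, hev, ?_, ?_⟩
  · refine natDegree_C_mul_le _ _ |>.trans ?_
    refine natDegree_add_le_of_degree_le hP0d ?_
    rw [natDegree_comp]; simpa using hP0d
  · intro t ht
    refine hsym t _ (k1 t ht) ?_
    have := k1 (-t) (by simpa using ht)
    simpa using this
  · intro z hz
    exact hsym z _ (k2 z hz) (k2 (-z) (by simpa using hz))


lemma eLp_quasi {μ : Measure ℝ} (p : ℝ≥0∞) (hp : 0 < p) (hp1 : p ≤ 1) (f g : ℝ → ℂ)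
    (hf : Continuous f) :
    eLpNorm (f + g) p μ ^ p.toReal ≤ eLpNorm f p μ ^ p.toReal + eLpNorm g p μ ^ p.toReal := by
  have hpt : p ≠ ⊤ := ne_top_of_le_ne_top ENNReal.one_ne_top hp1
  have hr : 0 < p.toReal := ENNReal.toReal_pos hp.ne' hpt
  have hr1 : p.toReal ≤ 1 := by simpa using ENNReal.toReal_mono ENNReal.one_ne_top hp1
  have e : ∀ h : ℝ → ℂ, eLpNorm h p μ ^ p.toReal = ∫⁻ x, ‖h x‖ₑ ^ p.toReal ∂μ := by
    intro h
    rw [eLpNorm_eq_lintegral_rpow_enorm_toReal hp.ne' hpt, ← ENNReal.rpow_mul, one_div,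
      inv_mul_cancel₀ hr.ne', ENNReal.rpow_one]
  rw [e, e, e, ← lintegral_add_left' (by
    exact (hf.measurable.enorm.pow_const _).aemeasurable)]
  refine lintegral_mono fun x => ?_
  calc _ ≤ (‖f x‖ₑ + ‖g x‖ₑ) ^ p.toReal := by
        gcongr; exact enorm_add_le _ _
    _ ≤ _ := ENNReal.rpow_add_le_add_rpow _ _ hr.le hr1

lemma upper_seq (ν : ℝ) (p : ℝ≥0∞) (hp : 0 < p) (g : ℝ → ℂ) (hg : Continuous g) (P : ℕ → ℝ → ℂ)
    (hP : ∀ n, Continuous (P n))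
    (hlim : Tendsto (fun n : ℕ => eLpNorm (fun t => P n t - g t) p (wMeas ν (Set.Icc (-(n:ℝ)) n))) atTop (𝓝 0)) :
    ∃ u : ℕ → ℝ≥0∞, Tendsto u atTop (𝓝 (eLpNorm g p (wMeas ν Set.univ))) ∧
      ∀ n, eLpNorm (P n) p (wMeas ν (Set.Icc (-(n:ℝ)) n)) ≤ u n := by
  set e := fun n : ℕ => eLpNorm (fun t => P n t - g t) p (wMeas ν (Set.Icc (-(n:ℝ)) n)) with he
  set Y := eLpNorm g p (wMeas ν Set.univ) with hY
  have hmono : ∀ n : ℕ, eLpNorm g p (wMeas ν (Set.Icc (-(n:ℝ)) n)) ≤ Y := fun n =>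
    eLpNorm_mono_measure _ (wMeas_mono ν (Set.subset_univ _))
  have heq : ∀ n, P n = g + fun t => P n t - g t := by intro n; ext t; simp
  rcases le_total 1 p with h1 | h1
  · refine ⟨fun n => Y + e n, by simpa using hlim.const_add Y, fun n => ?_⟩
    conv_lhs => rw [heq n]
    refine (eLpNorm_add_le hg.aestronglyMeasurable ((hP n).sub hg).aestronglyMeasurable h1).trans ?_
    exact add_le_add (hmono n) le_rfl
  · have hpt : p ≠ ⊤ := ne_top_of_le_ne_top ENNReal.one_ne_top h1
    have hr : 0 < p.toReal := ENNReal.toReal_pos hp.ne' hpt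
    refine ⟨fun n => (Y ^ p.toReal + e n ^ p.toReal) ^ p.toReal⁻¹, ?_, fun n => ?_⟩
    · have h2 : Tendsto (fun n => e n ^ p.toReal) atTop (𝓝 0) := by
        have := hlim.ennrpow_const p.toReal
        rwa [ENNReal.zero_rpow_of_pos hr] at this
      have h3 := (h2.const_add (Y ^ p.toReal)).ennrpow_const p.toReal⁻¹
      rwa [add_zero, ← ENNReal.rpow_mul, mul_inv_cancel₀ hr.ne', ENNReal.rpow_one] at h3
    · have h2 := eLp_quasi (μ := wMeas ν (Set.Icc (-(n:ℝ)) n)) p hp h1 g (fun t => P n t - g t) hg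
      rw [← heq n] at h2
      rw [ENNReal.le_rpow_inv_iff hr]
      refine h2.trans ?_
      gcongr
      exact hmono n

lemma lower_g (ν : ℝ) (hν : -(1/2) ≤ ν) (N : ℕ) (p : ℝ≥0∞) (hp : 0 < p)
    (g : ℂ → ℂ) (hg : Differentiable ℂ g) (he : ∀ z, g (-z) = g z) (C₀ σ : ℝ) (hσ0 : 0 ≤ σ)
    (hσ : σ < 1) (hC : ∀ z, ‖g z‖ ≤ C₀ * Real.exp (σ * |z.im|)) :
    rat ν N p Set.univ g ≤ liminf (cN ν N p) atTop := by
  obtain ⟨b, hb, hL⟩ := bessel_L ν hν N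
  by_cases hL0 : (besselOp ν)^[N] g 0 = 0
  · simp [rat, hL0]
  obtain ⟨γ, C', hγ, hP⟩ := approx_poly g hg he C₀ σ hσ0 hσ hC
  have hP' : ∀ n : ℕ, ∃ P : Polynomial ℂ, 0 < n → P.natDegree ≤ 2 * (n/2) ∧
      (∀ z, P.eval (-z) = P.eval z) ∧
      (∀ t : ℝ, |t| ≤ n → ‖P.eval (t:ℂ) - g t‖ ≤ C' * Real.exp (-(γ * n))) ∧
      (∀ z : ℂ, ‖z‖ ≤ 1 → ‖P.eval z - g z‖ ≤ C' * Real.exp (-(γ * n))) := by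
    intro n
    by_cases hn : 0 < n
    · obtain ⟨P, h⟩ := hP n hn; exact ⟨P, fun _ => h⟩
    · exact ⟨0, fun h => absurd h hn⟩
  choose P hP using hP'
  have hgc : Continuous fun t : ℝ => g t := hg.continuous.comp Complex.continuous_ofReal
  obtain ⟨u, hu1, hu2⟩ := upper_seq ν p hp (fun t : ℝ => g t) hgc (fun n t => (P n).eval (t:ℂ))
    (fun n => (P n).continuous.comp Complex.continuous_ofReal)
    (smallErr ν hν p C' γ hγ _ (by
      filter_upwards [eventually_gt_atTop 0] with n hn t ht
      exact (hP n hn).2.2.1 t ht))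
  -- convergence of the functional
  have hLlim : Tendsto (fun n => (besselOp ν)^[N] (fun z => (P n).eval z) 0) atTop (𝓝 ((besselOp ν)^[N] g 0)) := by
    rw [tendsto_iff_norm_sub_tendsto_zero]
    have hexp : Tendsto (fun n : ℕ => b * (C' * Real.exp (-(γ * n)))) atTop (𝓝 0) := by
      have h1 : Tendsto (fun n : ℕ => Real.exp (-(γ * n))) atTop (𝓝 0) :=
        Real.tendsto_exp_neg_atTop_nhds_zero.comp (tendsto_natCast_atTop_atTop.const_mul_atTop hγ)
      simpa using (h1.const_mul C').const_mul b
    refine squeeze_zero' (Eventually.of_forall fun _ => norm_nonneg _) ?_ hexp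
    filter_upwards [eventually_gt_atTop 0] with n hn
    obtain ⟨h1, h2, h3, h4⟩ := hP n hn
    rw [hL (P n).differentiable h2, hL hg he, ← mul_sub, norm_mul, Complex.norm_real, Real.norm_of_nonneg hb.le]
    have h5 := tc_add (P n).differentiable hg (-1) (2*N)
    have h6 := tc_bound (fun z => (P n).eval z + (-1) * g z)
      ((P n).differentiable.add (hg.const_mul (-1))) 1 _ one_pos (fun z hz => by
        have := h4 z hz.le
        rwa [show (P n).eval z + (-1) * g z = (P n).eval z - g z by ring]) (2*N)
    rw [h5] at h6
    rw [one_pow, div_one] at h6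
    refine mul_le_mul_of_nonneg_left ?_ hb.le
    rw [sub_eq_add_neg, ← neg_one_mul]
    exact h6
  have hlim : Tendsto (fun n => (‖(besselOp ν)^[N] (fun z => (P n).eval z) 0‖₊ : ℝ≥0∞) / u n) atTop
      (𝓝 (rat ν N p Set.univ g)) := by
    refine ENNReal.Tendsto.div ?_ (Or.inl ?_) hu1 (Or.inr ENNReal.coe_ne_top)
    · exact ENNReal.tendsto_coe.2 hLlim.nnnorm
    · simpa using hL0
  rw [← hlim.liminf_eq]
  refine liminf_le_liminf ?_
  filter_upwards [eventually_gt_atTop 0, hLlim.eventually_ne hL0] with n hn hn2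
  obtain ⟨h1, h2, h3, h4⟩ := hP n hn
  refine le_trans ?_ (rat_le_cN ν N p n hn (P n) h1 h2 ?_)
  · rw [rat]
    gcongr
    exact hu2 n
  · intro h0
    apply hn2
    rw [hL (P n).differentiable h2, tc_poly, h0]; simp

lemma lower_f (ν : ℝ) (hν : -(1/2) ≤ ν) (N : ℕ) (p : ℝ≥0∞) (hp : 0 < p)
    (f : ℂ → ℂ) (hf : SphericalType1 1 f) (he : ∀ z, f (-z) = f z)
    (hfin : eLpNorm (fun t : ℝ => f t) p (wMeas ν Set.univ) ≠ ⊤) :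
    rat ν N p Set.univ f ≤ liminf (cN ν N p) atTop := by
  obtain ⟨hd, ht⟩ := hf
  obtain ⟨C1, hC1⟩ := ht 1 one_pos
  obtain ⟨M, hM⟩ := bdd_real ν hν p hp f hd C1 (1 * (1+1)) (by norm_num) hC1 hfin
  have hρ : ∀ ρ : ℝ, 0 < ρ → ρ < 1 →
      ENNReal.ofReal (ρ ^ (2 * (N:ℝ) + (2*ν+2)/p.toReal)) * rat ν N p Set.univ f ≤ liminf (cN ν N p) atTop := by
    intro ρ h0 h1
    have hs := rat_scale ν N p ρ h0 Set.univ MeasurableSet.univ f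
    rw [Set.preimage_univ] at hs
    rw [← hs]
    obtain ⟨C2, hC2⟩ := ht ((1-ρ)/(2*ρ)) (div_pos (by linarith) (by linarith))
    have hdg : Differentiable ℂ fun z : ℂ => f (ρ * z) := hd.comp (by fun_prop)
    have heg : ∀ z : ℂ, f (ρ * -z) = f (ρ * z) := by intro z; rw [mul_neg, he]
    have hpl := pl_even (fun z => f (ρ * z)) hdg heg C2 ((1+ρ)/2) M (by linarith) (fun z => by
        refine (hC2 _).trans (le_of_eq ?_)
        rw [norm_mul, Complex.norm_real, Real.norm_of_nonneg h0.le]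
        congr 2; field_simp; ring) (fun x => by
        have := hM (ρ * x); simpa using this)
    exact lower_g ν hν N p hp _ hdg heg _ _ (by linarith) (by linarith) hpl
  have hcont : Tendsto (fun ρ : ℝ => ENNReal.ofReal (ρ ^ (2 * (N:ℝ) + (2*ν+2)/p.toReal)) * rat ν N p Set.univ f)
      (𝓝[<] 1) (𝓝 (1 * rat ν N p Set.univ f)) := by
    refine ENNReal.Tendsto.mul_const ?_ (Or.inl one_ne_zero)
    have : ContinuousAt (fun ρ : ℝ => ENNReal.ofReal (ρ ^ (2 * (N:ℝ) + (2*ν+2)/p.toReal))) 1 :=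
      ENNReal.continuous_ofReal.continuousAt.comp (Real.continuousAt_rpow_const _ _ (Or.inl one_ne_zero))
    have h := this.tendsto
    simp only [Real.one_rpow, ENNReal.ofReal_one] at h
    exact h.mono_left nhdsWithin_le_nhds
  rw [one_mul] at hcont
  refine le_of_tendsto hcont ?_
  filter_upwards [Ioo_mem_nhdsLT (show (0:ℝ) < 1 by norm_num)] with ρ hρ'
  exact hρ ρ hρ'.1 hρ'.2

lemma entireConst_le (ν : ℝ) (hν : -(1/2) ≤ ν) (N : ℕ) (p : ℝ≥0∞) (hp : 0 < p) :
    entireConst ν N p ≤ liminf (cN ν N p) atTop :=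
  iSup₂_le fun f hf => lower_f ν hν N p hp f hf.1 hf.2.1 hf.2.2.2


lemma tc_shift (g : ℂ → ℂ) (hg : Differentiable ℂ g) (m : ℕ) : tc (fun z => z ^ m * g z) m = g 0 := by
  have := tc_unique (fun z => z ^ m * g z) ((differentiable_id.pow m).mul hg)
    (fun k => if k < m then 0 else tc g (k - m)) (fun z => by
      rw [← hasSum_nat_add_iff' m]
      have h0 : ∑ i ∈ Finset.range m, (if i < m then 0 else tc g (i - m)) * z ^ i = 0 :=
        Finset.sum_eq_zero fun i hi => by simp [Finset.mem_range.1 hi]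
      rw [h0, sub_zero]
      have := (tc_hasSum g hg z).mul_left (z ^ m)
      refine this.congr_fun fun x => ?_
      rw [if_neg (by omega), Nat.add_sub_cancel, pow_add]; ring) m
  rw [this]; simp [tc_zero]

lemma finite_norm (ν : ℝ) (hν : -(1/2) ≤ ν) (p : ℝ≥0∞) (hp : 0 < p) :
    ∃ M : ℕ, ∀ (f : ℝ → ℂ) (C : ℝ), (∀ x, ‖f x‖ ≤ C * ((1 + |x|) ^ M)⁻¹) →
      eLpNorm f p (wMeas ν Set.univ) ≠ ⊤ := by
  rcases eq_or_ne p ⊤ with rfl | hpt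
  · refine ⟨0, fun f C h => ?_⟩
    rw [eLpNorm_exponent_top]
    refine (eLpNormEssSup_lt_top_of_ae_bound (C := C) (Eventually.of_forall fun x => ?_)).ne
    simpa using h x
  have hr : 0 < p.toReal := ENNReal.toReal_pos hp.ne' hpt
  obtain ⟨M, hM⟩ := exists_nat_gt ((2*ν+3) / p.toReal)
  rw [div_lt_iff₀ hr] at hM
  refine ⟨M, fun f C h => ?_⟩
  have hC : 0 ≤ C := by simpa using (norm_nonneg _).trans (h 0)
  rw [← lt_top_iff_ne_top, eLpNorm_lt_top_iff_lintegral_rpow_enorm_lt_top hp.ne' hpt]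
  have hb : ∀ x, ‖f x‖ₑ ^ p.toReal ≤ ENNReal.ofReal (C ^ p.toReal * (1 + |x|) ^ (-(M * p.toReal))) := by
    intro x
    have h1 : (0:ℝ) ≤ 1 + |x| := by positivity
    rw [← ofReal_norm, ENNReal.ofReal_rpow_of_nonneg (norm_nonneg _) hr.le]
    refine ENNReal.ofReal_le_ofReal ?_
    calc ‖f x‖ ^ p.toReal ≤ (C * ((1 + |x|) ^ M)⁻¹) ^ p.toReal :=
          Real.rpow_le_rpow (norm_nonneg _) (h x) hr.le
      _ = _ := by
        rw [Real.mul_rpow hC (by positivity), Real.inv_rpow (by positivity), ← Real.rpow_natCast,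
          ← Real.rpow_mul h1, Real.rpow_neg h1]
  refine (lintegral_mono hb).trans_lt ?_
  rw [wMeas, Measure.restrict_univ, lintegral_withDensity_eq_lintegral_mul _ (by fun_prop) (by fun_prop)]
  have hr2 : (1:ℝ) < M * p.toReal - (2*ν+1) := by linarith
  have hfin := finite_integral_one_add_norm (E := ℝ) (μ := volume) (r := M * p.toReal - (2*ν+1)) (by simpa using hr2)
  have hle : ∀ x : ℝ, ((fun t : ℝ => ENNReal.ofReal (|t| ^ (2 * ν + 1))) *
      fun x => ENNReal.ofReal (C ^ p.toReal * (1 + |x|) ^ (-(M * p.toReal)))) x ≤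
      ENNReal.ofReal (C ^ p.toReal) * ENNReal.ofReal ((1 + ‖x‖) ^ (-(M * p.toReal - (2*ν+1)))) := by
    intro x
    have h1 : (0:ℝ) < 1 + |x| := by positivity
    rw [Pi.mul_apply, ← ENNReal.ofReal_mul (by positivity), ← ENNReal.ofReal_mul (by positivity)]
    refine ENNReal.ofReal_le_ofReal ?_
    rw [show -(M * p.toReal - (2*ν+1)) = (2*ν+1) + -(M * p.toReal) by ring, Real.norm_eq_abs,
      Real.rpow_add h1]
    have h2 : |x| ^ (2*ν+1) ≤ (1 + |x|) ^ (2*ν+1) :=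
      Real.rpow_le_rpow (abs_nonneg _) (by linarith) (by linarith)
    have h3 : 0 ≤ C ^ p.toReal * (1 + |x|) ^ (-(M * p.toReal)) := by positivity
    nlinarith [mul_le_mul_of_nonneg_right h2 h3]
  refine (lintegral_mono hle).trans_lt ?_
  rw [lintegral_const_mul _ (by fun_prop)]
  exact ENNReal.mul_lt_top ENNReal.ofReal_lt_top hfin

lemma sin_norm_le (z : ℂ) : ‖Complex.sin z‖ ≤ Real.exp ‖z‖ := by
  rw [Complex.sin]
  have h1 : ‖Complex.exp (-z * Complex.I)‖ ≤ Real.exp ‖z‖ := by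
    refine (Complex.norm_exp_le_exp_norm _).trans (by simp)
  have h2 : ‖Complex.exp (z * Complex.I)‖ ≤ Real.exp ‖z‖ := by
    refine (Complex.norm_exp_le_exp_norm _).trans (by simp)
  have h3 := norm_sub_le (Complex.exp (-z * Complex.I)) (Complex.exp (z * Complex.I))
  rw [norm_div, norm_mul, Complex.norm_I, mul_one, Complex.norm_ofNat]
  linarith

lemma sinc_exists : ∃ (S : ℂ → ℂ) (C : ℝ), Differentiable ℂ S ∧ (∀ z, S (-z) = S z) ∧ S 0 = 1 ∧
    0 ≤ C ∧ (∀ z, ‖S z‖ ≤ C * Real.exp ‖z‖) ∧ ∀ x : ℝ, ‖S x‖ ≤ C * (1 + |x|)⁻¹ := by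
  set S := dslope Complex.sin 0 with hS
  have hd : Differentiable ℂ S := dslope_entire _ Complex.differentiable_sin
  have h0 : S 0 = 1 := by simp [hS, dslope_same]
  have hz : ∀ z, z ≠ 0 → S z = Complex.sin z / z := by
    intro z hz
    rw [hS, dslope_of_ne _ hz, slope_def_field]; simp
  obtain ⟨K, hK⟩ := (isCompact_closedBall (0:ℂ) 1).exists_bound_of_continuousOn hd.continuous.continuousOn
  have hK0 : 0 ≤ K := (norm_nonneg _).trans (hK 0 (by simp))
  refine ⟨S, 2 * K + 2, hd, fun z => ?_, h0, by positivity, fun z => ?_, fun x => ?_⟩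
  · by_cases h : z = 0
    · simp [h]
    · rw [hz z h, hz (-z) (by simpa), Complex.sin_neg, neg_div_neg_eq]
  · have he : 1 ≤ Real.exp ‖z‖ := Real.one_le_exp (norm_nonneg _)
    rcases le_total ‖z‖ 1 with h | h
    · have := hK z (by simpa using h)
      nlinarith
    · have hz0 : z ≠ 0 := by intro h'; norm_num [h'] at h
      rw [hz z hz0, norm_div]
      have := div_le_self (norm_nonneg (Complex.sin z)) h
      have := sin_norm_le z
      nlinarith
  · have h1 : 0 < 1 + |x| := by positivity
    rw [← div_eq_mul_inv, le_div_iff₀ h1]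
    rcases le_total |x| 1 with h | h
    · have := hK x (by simpa using h)
      nlinarith [norm_nonneg (S x)]
    · have hx0 : x ≠ 0 := by intro h'; norm_num [h'] at h
      rw [hz x (by exact_mod_cast hx0), norm_div, ← Complex.ofReal_sin, Complex.norm_real, Complex.norm_real,
        Real.norm_eq_abs, Real.norm_eq_abs, div_mul_eq_mul_div, div_le_iff₀ (by linarith)]
      nlinarith [Real.abs_sin_le_one x, abs_nonneg (Real.sin x)]

lemma exists_test (ν : ℝ) (hν : -(1/2) ≤ ν) (N : ℕ) (p : ℝ≥0∞) (hp : 0 < p) :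
    ∃ f : ℂ → ℂ, SphericalType1 1 f ∧ (∀ z : ℂ, f (-z) = f z) ∧ f ≠ 0 ∧
      eLpNorm (fun t : ℝ => f t) p (wMeas ν Set.univ) ≠ ⊤ ∧ (besselOp ν)^[N] f 0 ≠ 0 := by
  obtain ⟨b, hb, hL⟩ := bessel_L ν hν N
  obtain ⟨M, hM⟩ := finite_norm ν hν p hp
  obtain ⟨S, C, hS, hSe, hS0, hC, hSg, hSr⟩ := sinc_exists
  set K := 2 * N + M + 1 with hK
  have hK0 : (0:ℝ) < K := by positivity
  have hK1 : (1:ℝ) ≤ K := by exact_mod_cast (by omega : 1 ≤ K)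
  set g : ℂ → ℂ := fun z => S (z / K) ^ K with hg
  have hgd : Differentiable ℂ g := (hS.comp (differentiable_id.div_const _)).pow K
  set f : ℂ → ℂ := fun z => z ^ (2*N) * g z with hf
  have hfd : Differentiable ℂ f := (differentiable_id.pow _).mul hgd
  have hfe : ∀ z, f (-z) = f z := by
    intro z
    simp only [hf, hg]
    rw [neg_div, hSe, Even.neg_pow (even_two_mul N)]
  have hLf : (besselOp ν)^[N] f 0 ≠ 0 := by
    rw [hL hfd hfe, tc_shift g hgd]
    simp [hg, hS0, hb.ne']
  refine ⟨f, ⟨hfd, fun ε hε => ⟨(2*N).factorial / ε ^ (2*N) * C ^ K, fun z => ?_⟩⟩, hfe, ?_, ?_, hLf⟩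
  · have h1 := Real.pow_div_factorial_le_exp (x := ε * ‖z‖) (by positivity) (2*N)
    rw [div_le_iff₀ (by positivity), mul_pow] at h1
    have h2 : ‖z‖ ^ (2*N) ≤ (2*N).factorial / ε ^ (2*N) * Real.exp (ε * ‖z‖) := by
      rw [div_mul_eq_mul_div, le_div_iff₀ (by positivity)]; linarith
    have h3 : ‖g z‖ ≤ C ^ K * Real.exp ‖z‖ := by
      simp only [hg]
      rw [norm_pow]
      refine (pow_le_pow_left₀ (norm_nonneg _) (hSg _) K).trans (le_of_eq ?_)
      rw [mul_pow, ← Real.exp_nat_mul, norm_div, Complex.norm_natCast]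
      congr 2; field_simp
    simp only [hf]
    rw [norm_mul, norm_pow]
    refine (mul_le_mul h2 h3 (norm_nonneg _) (by positivity)).trans (le_of_eq ?_)
    rw [show 1 * (1 + ε) * ‖z‖ = ε * ‖z‖ + ‖z‖ by ring, Real.exp_add]; ring
  · intro h
    apply hLf
    rw [hL hfd hfe, h]; simp [tc]
  · refine hM _ ((C * K) ^ K) fun x => ?_
    have hx : 0 < 1 + |x| := by positivity
    have h1 : ‖S (x / K)‖ ≤ C * K * (1 + |x|)⁻¹ := by
      have := hSr (x / K)
      push_cast at this
      refine this.trans ?_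
      rw [mul_assoc]
      refine mul_le_mul_of_nonneg_left ?_ hC
      rw [← div_eq_mul_inv, inv_eq_one_div, div_le_div_iff₀ (by positivity) hx, abs_div, abs_of_pos hK0]
      have : (K:ℝ) * (1 + |x| / K) = K + |x| := by field_simp
      linarith
    simp only [hf, hg]
    rw [norm_mul, norm_pow, norm_pow, Complex.norm_real, Real.norm_eq_abs]
    have h2 := pow_le_pow_left₀ (norm_nonneg _) h1 K
    have h3 : |x| ^ (2*N) ≤ (1 + |x|) ^ (2*N) := pow_le_pow_left₀ (abs_nonneg _) (by linarith) _
    refine (mul_le_mul h3 h2 (by positivity) (by positivity)).trans ?_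
    rw [mul_pow _ _ K, inv_pow, mul_left_comm]
    refine mul_le_mul_of_nonneg_left ?_ (by positivity)
    rw [← div_eq_mul_inv, div_le_iff₀ (by positivity), inv_mul_eq_div, le_div_iff₀ (by positivity), ← pow_add]
    exact pow_le_pow_right₀ (by linarith [abs_nonneg x]) (by omega)

lemma entireConst_pos (ν : ℝ) (hν : -(1/2) ≤ ν) (N : ℕ) (p : ℝ≥0∞) (hp : 0 < p) :
    0 < entireConst ν N p := by
  obtain ⟨f, h1, h2, h3, h4, h5⟩ := exists_test ν hν N p hp
  refine lt_of_lt_of_le ?_ (le_iSup₂_of_le f ⟨h1, h2, h3, h4⟩ le_rfl)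
  exact ENNReal.div_pos (by simpa using h5) h4


lemma compact_limit (g : ℕ → ℂ → ℂ) (hg : ∀ j, Differentiable ℂ (g j)) (C : ℝ)
    (hC : ∀ j z, ‖g j z‖ ≤ C * Real.exp (2 * ‖z‖)) :
    ∃ (f : ℂ → ℂ) (φ : ℕ → ℕ), StrictMono φ ∧ Differentiable ℂ f ∧
      (∀ z, Tendsto (fun j => g (φ j) z) atTop (𝓝 (f z))) ∧
      ∀ k, Tendsto (fun j => tc (g (φ j)) k) atTop (𝓝 (tc f k)) := by
  have hb : ∀ R : ℝ, 0 < R → ∀ j k, ‖tc (g j) k‖ ≤ C * Real.exp (2 * R) / R ^ k := by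
    intro R hR j k
    exact tc_bound (g j) (hg j) R _ hR (fun z hz => by rw [← hz]; exact hC j z) k
  have hcomp : IsCompact (Set.univ.pi fun _ : ℕ => Metric.closedBall (0:ℂ) (C * Real.exp 2)) :=
    isCompact_univ_pi fun _ => isCompact_closedBall _ _
  obtain ⟨a, -, φ, hφ, ha⟩ := hcomp.tendsto_subseq (x := fun j k => tc (g j) k) (fun j => by
    intro k _
    simpa using hb 1 one_pos j k)
  rw [tendsto_pi_nhds] at ha
  have hak : ∀ R : ℝ, 0 < R → ∀ k, ‖a k‖ ≤ C * Real.exp (2 * R) / R ^ k := fun R hR k =>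
    le_of_tendsto (ha k).norm (Eventually.of_forall fun j => hb R hR _ k)
  have hdom : ∀ (z x : ℂ) (k : ℕ), ‖x‖ ≤ C * Real.exp (2 * (2 * (‖z‖ + 1))) / (2 * (‖z‖ + 1)) ^ k →
      ‖x * z ^ k‖ ≤ C * Real.exp (2 * (2 * (‖z‖ + 1))) * (1/2) ^ k := by
    intro z x k hx
    rw [norm_mul, norm_pow]
    have h1 : ‖z‖ ^ k ≤ (‖z‖ + 1) ^ k := pow_le_pow_left₀ (norm_nonneg _) (by linarith) k
    refine (mul_le_mul hx h1 (by positivity) ((norm_nonneg _).trans hx)).trans (le_of_eq ?_)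
    have : (‖z‖ + 1) ^ k ≠ 0 := by positivity
    rw [mul_pow, one_div, inv_pow]
    field_simp
  have hsum : ∀ z : ℂ, Summable fun k : ℕ => C * Real.exp (2 * (2 * (‖z‖ + 1))) * (1/2) ^ k := fun z =>
    summable_geometric_two.mul_left _
  have hf : ∀ z, HasSum (fun k => a k * z ^ k) (∑' k, a k * z ^ k) := fun z =>
    (Summable.of_norm_bounded (hsum z) fun k => hdom z _ k (hak _ (by positivity) k)).hasSum
  have hd := series_entire _ a hf
  refine ⟨fun z => ∑' k, a k * z ^ k, φ, hφ, hd, fun z => ?_, fun k => ?_⟩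
  · have := tendsto_tsum_of_dominated_convergence (𝓕 := atTop) (f := fun j k => tc (g (φ j)) k * z ^ k)
      (g := fun k => a k * z ^ k) (hsum z) (fun k => (ha k).mul_const _)
      (Eventually.of_forall fun j k => hdom z _ k (hb _ (by positivity) _ k))
    refine this.congr fun j => ?_
    exact (tc_hasSum _ (hg (φ j)) z).tsum_eq
  · rw [tc_unique _ hd a hf k]
    exact ha k

lemma eLp_indicator (ν : ℝ) (p : ℝ≥0∞) (s : Set ℝ) (hs : MeasurableSet s) (f : ℝ → ℂ) :
    eLpNorm (s.indicator f) p (wMeas ν Set.univ) = eLpNorm f p (wMeas ν s) := by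
  rw [eLpNorm_indicator_eq_eLpNorm_restrict hs, wMeas, wMeas, Measure.restrict_univ,
    restrict_withDensity hs]

lemma norm_seq (ν : ℝ) (N : ℕ) (p : ℝ≥0∞) (b : ℝ≥0∞) (hb : b < limsup (cN ν N p) atTop) (j : ℕ) :
    ∃ (n : ℕ) (P : Polynomial ℂ), j + 1 ≤ n ∧ P.natDegree ≤ n ∧ (∀ z, P.eval (-z) = P.eval z) ∧
      (besselOp ν)^[N] (fun z => P.eval z) 0 = 1 ∧
      b * eLpNorm (fun t : ℝ => P.eval (t:ℂ)) p (wMeas ν (Set.Icc (-(n:ℝ)) n)) ≤ 1 := by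
  have h1 : ∃ᶠ n in atTop, b < cN ν N p n := frequently_lt_of_lt_limsup (by isBoundedDefault) hb
  obtain ⟨n, hn, hbn⟩ := (frequently_atTop.1 h1) (j+1)
  obtain ⟨P, hd, he, hP⟩ := exists_of_lt_cN ν N p n (by omega) b hbn
  set l := (besselOp ν)^[N] (fun z => P.eval z) 0 with hl
  have hl0 : l ≠ 0 := by
    intro h
    rw [rat, ← hl, h] at hP
    simp at hP
  refine ⟨n, C l⁻¹ * P, hn, (natDegree_C_mul_le _ _).trans hd, fun z => by simp [he z], ?_, ?_⟩
  · have : (fun z => (C l⁻¹ * P).eval z) = fun z => l⁻¹ * P.eval z := by ext z; simp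
    rw [this, bessel_iter_smul]
    simp only
    rw [← hl, inv_mul_cancel₀ hl0]
  · have : (fun t : ℝ => (C l⁻¹ * P).eval (t:ℂ)) = l⁻¹ • fun t : ℝ => P.eval (t:ℂ) := by ext z; simp
    rw [this, eLpNorm_const_smul, mul_left_comm]
    have h2 := ENNReal.mul_le_of_le_div hP.le
    refine (mul_le_mul_right h2 _).trans ?_
    rw [← hl, enorm_inv hl0]
    exact ENNReal.inv_mul_le_one _

lemma exists_extremal (ν : ℝ) (hν : -(1/2) ≤ ν) (N : ℕ) (p : ℝ≥0∞) (hp : 0 < p)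
    (hpos : 0 < limsup (cN ν N p) atTop) :
    ∃ f : ℂ → ℂ, SphericalType1 1 f ∧ (∀ z : ℂ, f (-z) = f z) ∧ f ≠ 0 ∧
      eLpNorm (fun t : ℝ => f t) p (wMeas ν Set.univ) ≠ ⊤ ∧ ‖(besselOp ν)^[N] f 0‖₊ = 1 ∧
      limsup (cN ν N p) atTop ≤ rat ν N p Set.univ f := by
  set Cs := limsup (cN ν N p) atTop with hCs
  obtain ⟨b, hbm, hb, hbl⟩ := exists_seq_strictMono_tendsto' hpos
  choose n P hn hd he hLP hnorm using fun j => norm_seq ν N p (b j) (hb j).2 j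
  obtain ⟨β, hβ, hL⟩ := bessel_L ν hν N
  have hb0 : b 0 ≠ 0 := (hb 0).1.ne'
  have hnorm0 : ∀ j, eLpNorm (fun t : ℝ => (P j).eval (t:ℂ)) p (wMeas ν (Set.Icc (-(n j:ℝ)) (n j))) ≤ (b j)⁻¹ := by
    intro j
    rw [ENNReal.le_inv_iff_mul_le, mul_comm]
    exact hnorm j
  have hnormb : ∀ j, eLpNorm (fun t : ℝ => (P j).eval (t:ℂ)) p (wMeas ν (Set.Icc (-(n j:ℝ)) (n j))) ≤ (b 0)⁻¹ := by
    intro j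
    exact (hnorm0 j).trans (ENNReal.inv_le_inv.2 (hbm.monotone (Nat.zero_le j)))
  have hbinv : (b 0)⁻¹ ≠ ⊤ := ENNReal.inv_ne_top.2 hb0
  have hbound : ∀ δ : ℝ, 0 < δ → δ < 1 → ∃ C : ℝ, ∀ j z, ‖(P j).eval z‖ ≤ C * Real.exp ((1-δ)⁻¹ * ‖z‖) := by
    intro δ h0 h1
    obtain ⟨C, hC, h⟩ := nik_eLp ν hν p hp δ h0 h1 2 (by norm_num)
    refine ⟨C * (b 0)⁻¹.toReal, fun j z => ?_⟩
    have hnj : (1:ℝ) ≤ n j := by exact_mod_cast (by have := hn j; omega : 1 ≤ n j)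
    have hδ' : 0 < 1 - δ := by linarith
    have hreal : ∀ x : ℝ, |x| ≤ (1-δ) * n j → ‖(P j).eval (x:ℂ)‖ ≤ C * (b 0)⁻¹.toReal := by
      intro x hx
      have h2 := h (n j) hnj (P j) (by
        have : ((P j).natDegree : ℝ) ≤ n j := by exact_mod_cast hd j
        linarith) x hx
      have h3 := h2.trans (mul_le_mul_right (hnormb j) _)
      rw [← ENNReal.ofReal_toReal hbinv, ← ENNReal.ofReal_mul hC.le, ← ofReal_norm] at h3
      exact (ENNReal.ofReal_le_ofReal_iff (by positivity)).1 h3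
    have h4 := bernstein_growth (P j) (n j) (hd j) _ ((1-δ) * n j) (by positivity) hreal z
    refine h4.trans (le_of_eq ?_)
    congr 2
    have : (n j:ℝ) ≠ 0 := by positivity
    field_simp
  obtain ⟨C, hC⟩ := hbound (1/2) (by norm_num) (by norm_num)
  obtain ⟨f, φ, hφ, hfd, hlim, htc⟩ := compact_limit (fun j z => (P j).eval z) (fun j => (P j).differentiable) C
    (fun j z => by have := hC j z; norm_num at this; exact this)
  have hfe : ∀ z, f (-z) = f z := by
    intro z
    refine tendsto_nhds_unique (hlim (-z)) ?_
    simp only [he]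
    exact hlim z
  have hL1 : (besselOp ν)^[N] f 0 = 1 := by
    rw [hL hfd hfe]
    refine tendsto_nhds_unique ((htc (2*N)).const_mul (β:ℂ)) ?_
    refine tendsto_const_nhds.congr fun j => ?_
    rw [← hL (P (φ j)).differentiable (he _), hLP]
  have hfatou : eLpNorm (fun t : ℝ => f t) p (wMeas ν Set.univ) ≤ Cs⁻¹ := by
    have h1 := Lp.eLpNorm_lim_le_liminf_eLpNorm (μ := wMeas ν Set.univ) (p := p)
      (f := fun j => (Set.Icc (-(n (φ j):ℝ)) (n (φ j))).indicator (fun t : ℝ => (P (φ j)).eval (t:ℂ)))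
      (fun j => (((P (φ j)).continuous.comp Complex.continuous_ofReal).aestronglyMeasurable).indicator measurableSet_Icc)
      (fun t : ℝ => f t) (Eventually.of_forall fun t => by
        refine (hlim t).congr' ?_
        filter_upwards [eventually_ge_atTop ⌈|t|⌉₊] with j hj
        rw [Set.indicator_of_mem]
        have h2 : |t| ≤ n (φ j) := by
          have h3 : (⌈|t|⌉₊ : ℝ) ≤ n (φ j) := by
            exact_mod_cast (hj.trans (hφ.id_le j)).trans (by have := hn (φ j); change φ j ≤ n (φ j); omega)
          exact (Nat.le_ceil _).trans h3
        exact abs_le.1 h2)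
    refine h1.trans ?_
    have h2 : Tendsto (fun j => (b (φ j))⁻¹) atTop (𝓝 Cs⁻¹) :=
      tendsto_inv_iff.2 (hbl.comp hφ.tendsto_atTop)
    rw [← h2.liminf_eq]
    refine liminf_le_liminf (Eventually.of_forall fun j => ?_)
    rw [eLp_indicator _ _ _ measurableSet_Icc]
    exact hnorm0 (φ j)
  refine ⟨f, ⟨hfd, fun ε hε => ?_⟩, hfe, ?_, ?_, by simp [hL1], ?_⟩
  · obtain ⟨C, hC⟩ := hbound (ε / (1 + ε)) (by positivity) (by rw [div_lt_one (by positivity)]; linarith)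
    refine ⟨C, fun z => le_of_tendsto (hlim z).norm (Eventually.of_forall fun j => ?_)⟩
    have := hC (φ j) z
    rwa [show (1 - ε / (1 + ε))⁻¹ = 1 * (1 + ε) by
      have : 1 + ε ≠ 0 := by positivity
      rw [one_sub_div this]; simp] at this
  · intro h
    rw [hL hfd hfe, h] at hL1
    simp [tc] at hL1
  · exact ne_top_of_le_ne_top (ENNReal.inv_ne_top.2 hpos.ne') hfatou
  · rw [rat, hL1]
    simp only [nnnorm_one, ENNReal.coe_one, one_div]
    exact ENNReal.le_inv_iff_le_inv.1 hfatou

lemma cN_tendsto (ν : ℝ) (hν : -(1/2) ≤ ν) (N : ℕ) (p : ℝ≥0∞) (hp : 0 < p) :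
    Tendsto (cN ν N p) atTop (𝓝 (entireConst ν N p)) ∧
    ∃ f : ℂ → ℂ, SphericalType1 1 f ∧ (∀ z : ℂ, f (-z) = f z) ∧ f ≠ 0 ∧
      eLpNorm (fun t : ℝ => f t) p (wMeas ν Set.univ) ≠ ⊤ ∧ ‖(besselOp ν)^[N] f 0‖₊ = 1 ∧
      rat ν N p Set.univ f = entireConst ν N p := by
  have h1 := entireConst_le ν hν N p hp
  have h2 : liminf (cN ν N p) atTop ≤ limsup (cN ν N p) atTop := liminf_le_limsup
  have h0 := entireConst_pos ν hν N p hp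
  obtain ⟨f, ha, hb, hc, hd, he, hf⟩ := exists_extremal ν hν N p hp (h0.trans_le (h1.trans h2))
  have h3 : rat ν N p Set.univ f ≤ entireConst ν N p := le_iSup₂_of_le f ⟨ha, hb, hc, hd⟩ le_rfl
  refine ⟨tendsto_of_le_liminf_of_limsup_le h1 (hf.trans h3), f, ha, hb, hc, hd, he, le_antisymm h3 ?_⟩
  exact h1.trans (h2.trans hf)


lemma wMeas_half : wMeas (-(1/2)) Set.univ = volume := by
  rw [wMeas, Measure.restrict_univ]
  have : (fun t : ℝ => ENNReal.ofReal (|t| ^ (2 * (-(1/2):ℝ) + 1))) = 1 := by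
    ext t
    rw [show 2 * (-(1/2):ℝ) + 1 = 0 by norm_num]; simp
  rw [this, withDensity_one]

lemma sup_ge (f : ℝ → ℂ) (hf : Continuous f) (x : ℝ) : ‖f x‖ₑ ≤ eLpNorm f ⊤ volume := by
  have := ess_bound (-(1/2)) Set.univ MeasurableSet.univ f hf x univ_mem
  rwa [wMeas_half] at this

lemma essup_le (f : ℝ → ℂ) (M : ℝ≥0∞) {μ : Measure ℝ} (h : ∀ x, ‖f x‖ₑ ≤ M) : eLpNorm f ⊤ μ ≤ M := by
  rw [eLpNorm_exponent_top]
  exact essSup_le_of_ae_le _ (Eventually.of_forall h)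

lemma sup_scale (f : ℝ → ℂ) (c : ℝ) (hc : 0 < c) :
    eLpNorm (fun t => f (c * t)) ⊤ volume = eLpNorm f ⊤ volume := by
  have := eLp_scale (-(1/2)) ⊤ c hc Set.univ MeasurableSet.univ f
  rw [Set.preimage_univ, wMeas_half] at this
  simpa using this.symm

lemma sup_finite (ν : ℝ) (hν : -(1/2) ≤ ν) (N : ℕ) (p : ℝ≥0∞) (hp : 0 < p) (f : ℂ → ℂ)
    (hf : SphericalType1 1 f) (he : ∀ z : ℂ, f (-z) = f z)
    (hfin : eLpNorm (fun t : ℝ => f t) p (wMeas ν Set.univ) ≠ ⊤) :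
    eLpNorm (fun t : ℝ => (besselOp ν)^[N] f t) ⊤ volume ≠ ⊤ := by
  obtain ⟨C, hC⟩ := hf.2 1 one_pos
  norm_num at hC
  obtain ⟨M, hM⟩ := bdd_real ν hν p hp f hf.1 C 2 (by norm_num) hC hfin
  have h1 := pl_even f hf.1 he C 2 M (by norm_num) hC hM
  have hM0 : 0 ≤ max C M := le_max_of_le_right ((norm_nonneg _).trans (hM 0))
  have hSB : SB f := by
    intro h
    refine ⟨max C M * Real.exp (2 * h), fun z hz => (h1 z).trans ?_⟩
    exact mul_le_mul_of_nonneg_left (Real.exp_le_exp.2 (by linarith)) hM0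
  obtain ⟨K, hK⟩ := SB_bessel_iter ν N hf.1 he hSB 0
  refine ne_top_of_le_ne_top (ENNReal.ofReal_ne_top (r := K)) (essup_le _ _ fun x => ?_)
  rw [← ofReal_norm]
  exact ENNReal.ofReal_le_ofReal (hK x (by simp))

lemma R_scale (ν : ℝ) (N : ℕ) (p : ℝ≥0∞) (f : ℂ → ℂ) (c : ℝ) (hc : 0 < c) :
    eLpNorm (fun t : ℝ => (besselOp ν)^[N] (fun z => f (c * z)) t) ⊤ volume /
      eLpNorm (fun t : ℝ => f (c * t)) p (wMeas ν Set.univ) =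
    ENNReal.ofReal (c ^ (2 * (N:ℝ) + (2*ν+2) / p.toReal)) *
      (eLpNorm (fun t : ℝ => (besselOp ν)^[N] f t) ⊤ volume /
        eLpNorm (fun t : ℝ => f t) p (wMeas ν Set.univ)) := by
  have h1 : eLpNorm (fun t : ℝ => (besselOp ν)^[N] (fun z => f (c * z)) t) ⊤ volume =
      ENNReal.ofReal (c ^ (2 * (N:ℝ))) * eLpNorm (fun t : ℝ => (besselOp ν)^[N] f t) ⊤ volume := by
    have h2 := bessel_iter_scale ν (c:ℂ) (by exact_mod_cast hc.ne') N f
    have h3 : (fun t : ℝ => (besselOp ν)^[N] (fun z => f (c * z)) t) =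
        ((c:ℂ) ^ (2*N)) • fun t : ℝ => (besselOp ν)^[N] f ((c * t : ℝ):ℂ) := by
      ext t; rw [h2]; simp
    rw [h3, eLpNorm_const_smul, sup_scale (fun t : ℝ => (besselOp ν)^[N] f t) c hc]
    congr 1
    rw [← ofReal_norm, norm_pow, Complex.norm_real, Real.norm_of_nonneg hc.le, ← Real.rpow_natCast]
    push_cast; rfl
  have h4 := eLp_scale ν p c hc Set.univ MeasurableSet.univ (fun t : ℝ => f t)
  rw [Set.preimage_univ] at h4
  push_cast at h4
  rw [h1, h4, ratio_aux _ (c ^ ((2*ν+2) / p.toReal)) (by positivity) (by positivity), Real.rpow_add hc]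

lemma exists_final (ν : ℝ) (hν : -(1/2) ≤ ν) (N : ℕ) (p : ℝ≥0∞) (hp : 0 < p) (f : ℂ → ℂ)
    (hf : SphericalType1 1 f) (he : ∀ z : ℂ, f (-z) = f z) (h0 : f ≠ 0)
    (hfin : eLpNorm (fun t : ℝ => f t) p (wMeas ν Set.univ) ≠ ⊤)
    (hL : ‖(besselOp ν)^[N] f 0‖₊ = 1) (hE : rat ν N p Set.univ f = entireConst ν N p) :
    ∃ f₀ : ℂ → ℂ, SphericalType1 1 f₀ ∧ (∀ z : ℂ, f₀ (-z) = f₀ z) ∧ f₀ ≠ 0 ∧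
      eLpNorm (fun t : ℝ => f₀ t) p (wMeas ν Set.univ) ≠ ⊤ ∧
      eLpNorm (fun t : ℝ => (besselOp ν)^[N] f₀ t) ⊤ volume /
        eLpNorm (fun t : ℝ => f₀ t) p (wMeas ν Set.univ) = entireConst ν N p := by
  set R := eLpNorm (fun t : ℝ => (besselOp ν)^[N] f t) ⊤ volume /
        eLpNorm (fun t : ℝ => f t) p (wMeas ν Set.univ) with hR
  have hER : entireConst ν N p ≤ R := by
    rw [← hE, rat, hR]
    refine ENNReal.div_le_div_right ?_ _
    have := sup_ge (fun t : ℝ => (besselOp ν)^[N] f t)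
      ((bessel_iter ν N hf.1 he).1.continuous.comp Complex.continuous_ofReal) 0
    simpa [enorm_eq_nnnorm] using this
  rcases hER.eq_or_lt with h | hlt
  · exact ⟨f, hf, he, h0, hfin, h.symm⟩
  have hEpos := entireConst_pos ν hν N p hp
  have hY0 : eLpNorm (fun t : ℝ => f t) p (wMeas ν Set.univ) ≠ 0 := by
    intro h
    rw [rat, h, hL] at hE
    simp at hE
    rw [← hE] at hlt
    simp at hlt
  have hRt : R ≠ ⊤ := ENNReal.div_ne_top (sup_finite ν hν N p hp f hf he hfin) hY0
  have hR0 : R ≠ 0 := (hEpos.trans hlt).ne'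
  set s := 2 * (N:ℝ) + (2*ν+2) / p.toReal with hs
  have hs0 : 0 ≤ s := by
    have : 0 ≤ 2*ν+2 := by linarith
    positivity
  rcases hs0.eq_or_lt with hs1 | hs1
  · exfalso
    have h2 : 0 ≤ (2*ν+2) / p.toReal := div_nonneg (by linarith) ENNReal.toReal_nonneg
    have hN : N = 0 := by
      have : (0:ℝ) ≤ N := by positivity
      exact_mod_cast (by linarith : (N:ℝ) = 0)
    have h3 : (2*ν+2) / p.toReal = 0 := by
      have : (0:ℝ) ≤ N := by positivity
      linarith
    have hpt : p = ⊤ := by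
      rcases div_eq_zero_iff.1 h3 with h | h
      · linarith
      · rcases (ENNReal.toReal_eq_zero_iff _).1 h with h | h
        · exact absurd h hp.ne'
        · exact h
    subst hN hpt
    have hR1 : R ≤ 1 := by
      rw [hR]
      refine (ENNReal.div_le_div_right (b := eLpNorm (fun t : ℝ => f t) ⊤ (wMeas ν Set.univ)) ?_ _).trans
        ENNReal.div_self_le_one
      refine essup_le _ _ fun x => ?_
      exact ess_bound ν Set.univ MeasurableSet.univ (fun t : ℝ => f t)
        (hf.1.continuous.comp Complex.continuous_ofReal) x univ_mem
    have hY : eLpNorm (fun _ : ℝ => (1:ℂ)) ⊤ (wMeas ν Set.univ) ≤ 1 := essup_le _ _ fun x => by simp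
    have hE1 : 1 ≤ entireConst ν 0 ⊤ := by
      refine le_iSup₂_of_le (fun _ => (1:ℂ)) ⟨⟨differentiable_const _, fun ε hε => ⟨1, fun z => ?_⟩⟩,
        fun _ => rfl, ?_, ?_⟩ ?_
      · rw [norm_one, one_mul]
        exact Real.one_le_exp (by positivity)
      · intro h; simpa using congrFun h 0
      · exact ne_top_of_le_ne_top ENNReal.one_ne_top hY
      · simp only [Function.iterate_zero, id, nnnorm_one, ENNReal.coe_one, one_div]
        exact ENNReal.one_le_inv.2 hY
    exact absurd hlt (not_lt.2 (hR1.trans hE1))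
  · set q := (entireConst ν N p / R).toReal with hq
    have hEt : entireConst ν N p ≠ ⊤ := ne_top_of_lt hlt
    have hq1 : entireConst ν N p / R ≤ 1 := ENNReal.div_le_of_le_mul (by simpa using hlt.le)
    have hqt : entireConst ν N p / R ≠ ⊤ := ne_top_of_le_ne_top ENNReal.one_ne_top hq1
    have hqpos : 0 < q := ENNReal.toReal_pos (ENNReal.div_pos hEpos.ne' hRt).ne' hqt
    have hqle : q ≤ 1 := by
      have := ENNReal.toReal_mono ENNReal.one_ne_top hq1
      rwa [ENNReal.toReal_one] at this
    set c := q ^ s⁻¹ with hc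
    have hc0 : 0 < c := by positivity
    have hc1 : c ≤ 1 := Real.rpow_le_one hqpos.le hqle (by positivity)
    have hcs : c ^ s = q := by rw [hc, ← Real.rpow_mul hqpos.le, inv_mul_cancel₀ hs1.ne', Real.rpow_one]
    have hcC : (c:ℂ) ≠ 0 := by exact_mod_cast hc0.ne'
    refine ⟨fun z => f (c * z), ⟨hf.1.comp (differentiable_id.const_mul _), fun ε hε => ?_⟩,
      fun z => ?_, ?_, ?_, ?_⟩
    · obtain ⟨C, hC⟩ := hf.2 ε hε
      have hC0 : 0 ≤ C := by simpa using (norm_nonneg _).trans (hC 0)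
      refine ⟨C, fun z => (hC _).trans (mul_le_mul_of_nonneg_left (Real.exp_le_exp.2 ?_) hC0)⟩
      rw [norm_mul, Complex.norm_real, Real.norm_of_nonneg hc0.le]
      refine mul_le_mul_of_nonneg_left ?_ (by positivity)
      exact mul_le_of_le_one_left (norm_nonneg _) hc1
    · simp only [mul_neg, he]
    · intro h
      apply h0
      ext z
      have := congrFun h (z / c)
      simpa [mul_div_cancel₀, hcC, mul_div_assoc'] using this
    · have h4 := eLp_scale ν p c hc0 Set.univ MeasurableSet.univ (fun t : ℝ => f t)
      rw [Set.preimage_univ] at h4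
      push_cast at h4
      intro h
      rw [h, ENNReal.mul_top (by simpa using Real.rpow_pos_of_pos hc0 _)] at h4
      exact hfin h4
    · rw [R_scale ν N p f c hc0, ← hs, hcs, hq, ENNReal.ofReal_toReal hqt]
      exact ENNReal.div_mul_cancel hR0 hRt

/-- **Theorem 4.1.**  For `ν ≥ -1/2`, `N ≥ 0` and `p ∈ (0,∞]`,
`n^{-2N-(2ν+2)/p}` times the sharp polynomial constant tends to the sharp constant for
even entire functions of exponential type `1`, and the limit is attained by some
nonzero `f₀ ∈ E_{1,1,e} ∩ L_{p,|t|^{2ν+1}}(ℝ)` in the form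
`‖(Be_ν)^N f₀‖_{L_∞(ℝ)} / ‖f₀‖_{L_{p,|t|^{2ν+1}}(ℝ)}`  (`1/∞ = 0`). -/
theorem limit_bessel_sharp_constants
    {ν : ℝ} (hν : -(1/2 : ℝ) ≤ ν) (N : ℕ) (p : ℝ≥0∞) (hp : 0 < p) :
    Tendsto
      (fun n : ℕ =>
        ENNReal.ofReal ((n : ℝ) ^ (-(2 * (N : ℝ)) - (2 * ν + 2) / p.toReal)) *
          polyConst ν N p n)
      atTop (𝓝 (entireConst ν N p)) ∧
    ∃ f₀ : ℂ → ℂ, SphericalType1 1 f₀ ∧ (∀ z : ℂ, f₀ (-z) = f₀ z) ∧ f₀ ≠ 0 ∧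
      eLpNorm (fun t : ℝ => f₀ t) p (wMeas ν Set.univ) ≠ ⊤ ∧
      Tendsto
        (fun n : ℕ =>
          ENNReal.ofReal ((n : ℝ) ^ (-(2 * (N : ℝ)) - (2 * ν + 2) / p.toReal)) *
            polyConst ν N p n)
        atTop
        (𝓝 (eLpNorm (fun t : ℝ => (besselOp ν)^[N] f₀ t) ⊤ volume /
          eLpNorm (fun t : ℝ => f₀ t) p (wMeas ν Set.univ))) := by
  obtain ⟨h, f, h1, h2, h3, h4, h5, h6⟩ := cN_tendsto ν hν N p hp
  obtain ⟨g, g1, g2, g3, g4, g5⟩ := exists_final ν hν N p hp f h1 h2 h3 h4 h5 h6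
  refine ⟨h, g, g1, g2, g3, g4, ?_⟩
  rw [g5]
  exact h
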